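/- Let n ≥ 2, β ≥ 0, 0 < ε < 1, 0 < δ < 1, C₀ > 1 and let χ be a cutoff. Assume α satisfies one of: (i) (n−3)/2 + ε < β < (n−1)/2 and α ≤ 2β − (n−3)/2 − ε; or (ii) β ≥ (n−1)/2 and α < β + 1 − ε. Then there exists a constant C > 0 such that for every θ ∈ S^{n−1}, every 0 < λ < 1 and every Schwartz function q on ℝⁿ, the sublinear operator P^λ(q)(η) := 1_{{k(η,θ)² > δ/λ}} · ∫_{{r > 0 : |1−r| ≤ λ}} | χ(η) S_{θ,r}(q)(η) | dr (for η ∈ H_θ, and := 0 for η ∉ H_θ) satisfies ‖P^λ(q)‖_{L²_α} ≤ C λ^{1+ε/2} ‖q‖²_{W^{β,2}_2}. -/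

import Mathlib

open MeasureTheory Real Filter Set Metric
open scoped FourierTransform RealInnerProductSpace SchwartzMap ENNReal

noncomputable section

abbrev En (n : ℕ) := EuclideanSpace ℝ (Fin n)

/-- Japanese bracket `⟨x⟩ = (1+|x|²)^{1/2}`. -/
def jap {n : ℕ} (x : En n) : ℝ := Real.sqrt (1 + ‖x‖ ^ 2)

/-- `k(η,θ) = -|η|²/(θ·η)`. -/
def kval {n : ℕ} (θ η : En n) : ℝ := -‖η‖ ^ 2 / ⟪θ, η⟫

/-- The Ewald sphere `Γ_r(-2kθ)`, of center `-kθ` and radius `rk`. -/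
def ewald {n : ℕ} (θ η : En n) (r : ℝ) : Set (En n) :=
  Metric.sphere (-(kval θ η • θ)) (r * kval θ η)

/-- The spherical operator `S_{θ,r}`. -/
def Sop {n : ℕ} (θ : En n) (r : ℝ) (q : En n → ℂ) (η : En n) : ℂ :=
  if ⟪η, θ⟫ < 0 then
    ((kval θ η * (r + 1))⁻¹ : ℝ) •
      ∫ ξ in ewald θ η r, 𝓕 q ξ * 𝓕 q (η - ξ) ∂μH[(n : ℝ) - 1]
  else 0

/-- The operator `K_r(g₁,g₂)`. -/
def Kop {n : ℕ} {G₁ G₂ : Type*} [NormedAddCommGroup G₁] [NormedAddCommGroup G₂]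
    (θ : En n) (r : ℝ) (g₁ : En n → G₁) (g₂ : En n → G₂) (η : En n) : ℝ :=
  if ⟪η, θ⟫ < 0 then
    (kval θ η)⁻¹ * ∫ ξ in ewald θ η r, ‖g₁ ξ‖ * ‖g₂ (η - ξ)‖ ∂μH[(n : ℝ) - 1]
  else 0

/-- Weighted norm `‖F‖_{L²_α}`. -/
def L2w {n : ℕ} {G : Type*} [NormedAddCommGroup G] (α : ℝ) (F : En n → G) : ℝ :=
  (∫ η, jap η ^ (2 * α) * ‖F η‖ ^ 2) ^ (1/2 : ℝ)

/-- Weighted Sobolev norm `‖q‖_{W^{β,2}_δ} = ‖⟨·⟩^δ 𝓕⁻¹(⟨·⟩^β 𝓕q)‖_{L²}`. -/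
def sobNorm {n : ℕ} (β δ : ℝ) (q : En n → ℂ) : ℝ :=
  (∫ x, jap x ^ (2 * δ) * ‖𝓕⁻ (fun ξ => (jap ξ ^ β : ℝ) • 𝓕 q ξ) x‖ ^ 2) ^ (1/2 : ℝ)

/-- A smooth radial cutoff vanishing for `|ξ| < C₀` and equal to `1` for `|ξ| > 2C₀`. -/
structure IsCutoff {n : ℕ} (C₀ : ℝ) (χ : En n → ℝ) : Prop where
  smooth : ContDiff ℝ (⊤ : ℕ∞) χ
  mem_Icc : ∀ ξ, χ ξ ∈ Set.Icc (0 : ℝ) 1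
  eq_one : ∀ ξ : En n, 2 * C₀ < ‖ξ‖ → χ ξ = 1
  eq_zero : ∀ ξ : En n, ‖ξ‖ < C₀ → χ ξ = 0


lemma exists_split (m : ℕ) (θ : En (m+1)) (hθ : ‖θ‖ = 1) :
    ∃ I : En m →ₗᵢ[ℝ] En (m+1), (∀ w, ⟪θ, I w⟫ = 0) ∧
      ∀ g : En (m+1) → ℝ≥0∞, Measurable g → ∫⁻ y, g y = ∫⁻ t : ℝ, ∫⁻ w : En m, g (t • θ + I w) := by
  classical
  have hv : Orthonormal ℝ (({0} : Set (Fin (m+1))).domRestrict (fun _ => θ)) := by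
    constructor
    · intro i; simpa using hθ
    · intro i j hij
      exact absurd (Subsingleton.elim i j) hij
  obtain ⟨b, hb⟩ := hv.exists_orthonormalBasis_extension_of_card_eq (by simp)
  have hb0 : b 0 = θ := hb 0 (by simp)
  let I : En m →ₗᵢ[ℝ] En (m+1) :=
    { toFun := fun w => ∑ i : Fin m, w i • b i.succ
      map_add' := by intro x y; simp [add_smul, Finset.sum_add_distrib]
      map_smul' := by intro c x; simp [Finset.smul_sum, smul_smul]
      norm_map' := by
        intro w
        have h : Orthonormal ℝ (fun i : Fin m => b i.succ) :=
          b.orthonormal.comp _ (Fin.succ_injective m)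
        change ‖∑ i : Fin m, w i • b i.succ‖ = ‖w‖
        have h2 : ‖∑ i : Fin m, w i • b i.succ‖ ^ 2 = ‖w‖ ^ 2 := by
          rw [← real_inner_self_eq_norm_sq, h.inner_sum, EuclideanSpace.real_norm_sq_eq]
          simp [pow_two]
        exact (sq_eq_sq₀ (norm_nonneg _) (norm_nonneg _)).1 h2 }
  have hI : ∀ w, I w = ∑ i : Fin m, w i • b i.succ := fun w => rfl
  refine ⟨I, ?_, ?_⟩
  · intro w
    rw [hI, inner_sum, ← hb0]
    apply Finset.sum_eq_zero
    intro i _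
    rw [inner_smul_right, b.orthonormal.2 (Fin.succ_ne_zero i).symm, mul_zero]
  · intro g hg
    have h1 := b.measurePreserving_repr_symm
    have h2 := (EuclideanSpace.volume_preserving_symm_measurableEquiv_toLp (Fin (m+1))).symm
    have h3 := (volume_preserving_piFinSuccAbove (fun _ : Fin (m+1) => ℝ) 0).symm
    have h4 := (EuclideanSpace.volume_preserving_symm_measurableEquiv_toLp (Fin m))
    rw [← h1.lintegral_comp hg]
    rw [← h2.lintegral_comp (by fun_prop)]
    rw [← h3.lintegral_comp (by fun_prop)]
    rw [Measure.volume_eq_prod, lintegral_prod _ (by fun_prop)]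
    congr 1
    ext t
    rw [← h4.lintegral_comp (by fun_prop)]
    congr 1
    ext w
    congr 1
    rw [← OrthonormalBasis.sum_repr_symm]
    simp [Fin.sum_univ_succ, hb0, hI, MeasurableEquiv.piFinSuccAbove]

def kern (m : ℕ) (p b u : ℝ) : ℝ≥0∞ :=
  ∫⁻ w : En m, ENNReal.ofReal ((u^2 + ‖w‖^2) ^ (-p/2) * ‖w‖ ^ (-b))

lemma kern_finite (m : ℕ) (hm : 1 ≤ m) (p b : ℝ) (hp : 0 ≤ p) (hbm : b < m)
    (hpb : (m:ℝ) < p + b) : kern m p b 1 < ⊤ := by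
  haveI : Nonempty (Fin m) := ⟨⟨0, hm⟩⟩
  have hI : Integrable (fun w : En m => (1^2 + ‖w‖^2) ^ (-p/2) * ‖w‖ ^ (-b)) := by
    rw [integrable_fun_norm_addHaar volume (f := fun y : ℝ => (1^2 + y^2) ^ (-p/2) * y ^ (-b))]
    rw [← Ioc_union_Ioi_eq_Ioi (zero_le_one (α := ℝ)), integrableOn_union]
    have hfr : Module.finrank ℝ (En m) = m := by simp
    rw [hfr]
    have key : ∀ y : ℝ, 0 < y → y ^ (m-1) * y ^ (-b) = y ^ ((m:ℝ) - 1 - b) := by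
      intro y hy
      rw [← Real.rpow_natCast, ← Real.rpow_add hy]
      congr 1
      push_cast [hm]
      ring
    constructor
    · have h1 : IntegrableOn (fun y : ℝ => y ^ ((m:ℝ) - 1 - b)) (Ioc 0 1) := by
        have := (intervalIntegral.intervalIntegrable_rpow' (a := 0) (b := 1)
          (r := (m:ℝ) - 1 - b) (by linarith))
        rwa [intervalIntegrable_iff_integrableOn_Ioc_of_le zero_le_one] at this
      refine Integrable.mono' h1 (by fun_prop) ?_
      filter_upwards [ae_restrict_mem measurableSet_Ioc] with y hy
      have hy0 : 0 < y := hy.1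
      rw [← key y hy0, smul_eq_mul, norm_of_nonneg (by positivity)]
      have : (1^2 + y^2) ^ (-p/2) ≤ (1:ℝ) :=
        Real.rpow_le_one_of_one_le_of_nonpos (by nlinarith) (by linarith)
      gcongr
      have h0 : 0 ≤ y ^ (-b) := by positivity
      nlinarith
    · have h1 : IntegrableOn (fun y : ℝ => y ^ ((m:ℝ) - 1 - b - p)) (Ioi 1) :=
        integrableOn_Ioi_rpow_of_lt (by linarith) one_pos
      refine Integrable.mono' h1 (by fun_prop) ?_
      filter_upwards [ae_restrict_mem measurableSet_Ioi] with y hy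
      have hy0 : 0 < y := lt_trans one_pos hy
      rw [sub_eq_add_neg _ p, Real.rpow_add hy0, ← key y hy0, smul_eq_mul,
        norm_of_nonneg (by positivity)]
      have : (1^2 + y^2) ^ (-p/2) ≤ y ^ (-p) := by
        calc (1^2 + y^2) ^ (-p/2) ≤ (y^2) ^ (-p/2) :=
              Real.rpow_le_rpow_of_nonpos (by positivity) (by linarith) (by linarith)
          _ = y ^ (-p) := by
              rw [← Real.rpow_natCast, ← Real.rpow_mul hy0.le]; congr 1; push_cast; ring
      rw [mul_comm (_ ^ (-p/2)), ← mul_assoc]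
      gcongr
  exact hI.lintegral_lt_top

lemma kern_scale (m : ℕ) (p b u : ℝ) (hu : 0 < u) :
    kern m p b u = ENNReal.ofReal (u ^ ((m:ℝ) - p - b)) * kern m p b 1 := by
  have hmap := Measure.map_addHaar_smul (volume : Measure (En m)) hu.ne'
  have hfr : Module.finrank ℝ (En m) = m := by simp
  rw [hfr] at hmap
  have h1 : ∫⁻ w : En m, ENNReal.ofReal ((u^2 + ‖u • w‖^2) ^ (-p/2) * ‖u • w‖ ^ (-b))
      = ENNReal.ofReal |(u^m)⁻¹| * kern m p b u := by
    rw [kern, ← smul_eq_mul, ← lintegral_smul_measure, ← hmap, lintegral_map (by fun_prop) (by fun_prop)]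
  have h2 : ∫⁻ w : En m, ENNReal.ofReal ((u^2 + ‖u • w‖^2) ^ (-p/2) * ‖u • w‖ ^ (-b))
      = ENNReal.ofReal (u ^ (-p-b)) * kern m p b 1 := by
    rw [kern, ← lintegral_const_mul _ (by fun_prop)]
    congr 1
    ext w
    rw [← ENNReal.ofReal_mul (by positivity)]
    congr 1
    rw [norm_smul, norm_of_nonneg hu.le, Real.mul_rpow hu.le (norm_nonneg _)]
    have : u^2 + (u * ‖w‖)^2 = u^2 * (1^2 + ‖w‖^2) := by ring
    rw [this, Real.mul_rpow (by positivity) (by positivity), sub_eq_add_neg, Real.rpow_add hu]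
    have : (u^2) ^ (-p/2) = u ^ (-p) := by
      rw [← Real.rpow_natCast, ← Real.rpow_mul hu.le]; congr 1; push_cast; ring
    rw [this]; ring
  have h3 : kern m p b u = ENNReal.ofReal (u^m) * (ENNReal.ofReal |(u^m)⁻¹| * kern m p b u) := by
    rw [← mul_assoc, ← ENNReal.ofReal_mul (by positivity), abs_of_pos (by positivity),
      mul_inv_cancel₀ (by positivity)]
    simp
  rw [h3, ← h1, h2, ← mul_assoc, ← ENNReal.ofReal_mul (by positivity), ← Real.rpow_natCast,
    ← Real.rpow_add hu]
  congr 3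
  ring

lemma kern_shift (m : ℕ) (p b u : ℝ) (hu : 0 < u) (hp : 0 ≤ p) (hb : 0 ≤ b) (hm : 1 ≤ m)
    (w₀ : En m) :
    ∫⁻ w : En m, ENNReal.ofReal ((u^2 + ‖w‖^2) ^ (-p/2) * ‖w - w₀‖ ^ (-b)) ≤
      ENNReal.ofReal (1 + 2 ^ (p/2)) * kern m p b u := by
  haveI : Nonempty (Fin m) := ⟨⟨0, hm⟩⟩
  have hshift : kern m p b u =
      ∫⁻ w : En m, ENNReal.ofReal ((u^2 + ‖w - w₀‖^2) ^ (-p/2) * ‖w - w₀‖ ^ (-b)) :=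
    (lintegral_sub_right_eq_self (μ := volume)
      (fun w : En m => ENNReal.ofReal ((u^2 + ‖w‖^2) ^ (-p/2) * ‖w‖ ^ (-b))) w₀).symm
  rw [ENNReal.ofReal_add (by positivity) (by positivity), add_mul, ENNReal.ofReal_one, one_mul]
  nth_rewrite 2 [hshift]
  rw [kern, ← lintegral_const_mul _ (by fun_prop), ← lintegral_add_left (by fun_prop)]
  refine lintegral_mono_ae ?_
  have hne : ∀ a : En m, ∀ᵐ w : En m, w ≠ a := fun a => by
    simp [ae_iff]
  filter_upwards [hne 0, hne w₀] with w hw hw0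
  have hw1 : 0 < ‖w‖ := norm_pos_iff.2 hw
  have hw2 : 0 < ‖w - w₀‖ := norm_pos_iff.2 (sub_ne_zero.2 hw0)
  rw [← ENNReal.ofReal_mul (by positivity), ← ENNReal.ofReal_add (by positivity) (by positivity)]
  apply ENNReal.ofReal_le_ofReal
  by_cases h : ‖w‖ ≤ ‖w - w₀‖
  · have : ‖w - w₀‖ ^ (-b) ≤ ‖w‖ ^ (-b) :=
      Real.rpow_le_rpow_of_nonpos hw1 h (by linarith)
    have h3 : (u^2 + ‖w‖^2) ^ (-p/2) * ‖w - w₀‖ ^ (-b) ≤ (u^2 + ‖w‖^2) ^ (-p/2) * ‖w‖ ^ (-b) := by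
      gcongr
    have h4 : 0 ≤ 2 ^ (p/2) * ((u^2 + ‖w - w₀‖^2) ^ (-p/2) * ‖w - w₀‖ ^ (-b)) := by positivity
    linarith
  · push Not at h
    have : (u^2 + ‖w‖^2) ^ (-p/2) ≤ 2 ^ (p/2) * (u^2 + ‖w - w₀‖^2) ^ (-p/2) := by
      have e : (2:ℝ) ^ (p/2) = (1/2) ^ (-p/2) := by
        rw [neg_div, one_div, Real.inv_rpow (by norm_num), Real.rpow_neg (by norm_num), inv_inv]
      rw [e, ← Real.mul_rpow (by norm_num) (by positivity)]
      apply Real.rpow_le_rpow_of_nonpos (by positivity) _ (by linarith)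
      nlinarith
    have h3 : (u^2 + ‖w‖^2) ^ (-p/2) * ‖w - w₀‖ ^ (-b) ≤
        2 ^ (p/2) * (u^2 + ‖w - w₀‖^2) ^ (-p/2) * ‖w - w₀‖ ^ (-b) := by gcongr
    have h4 : 0 ≤ (u^2 + ‖w‖^2) ^ (-p/2) * ‖w‖ ^ (-b) := by positivity
    linarith

lemma lint_two (F : ℝ → ℝ≥0∞) (a₁ b₁ M₁ a₂ b₂ M₂ C : ℝ) (hM₁ : 0 ≤ M₁) (hM₂ : 0 ≤ M₂)
    (hab₁ : a₁ ≤ b₁) (hab₂ : a₂ ≤ b₂)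
    (h : ∀ t, F t ≠ 0 → (t ∈ Icc a₁ b₁ ∧ F t ≤ ENNReal.ofReal M₁) ∨
      (t ∈ Icc a₂ b₂ ∧ F t ≤ ENNReal.ofReal M₂))
    (hC : M₁ * (b₁ - a₁) + M₂ * (b₂ - a₂) ≤ C) : ∫⁻ t, F t ≤ ENNReal.ofReal C := by
  calc ∫⁻ t, F t ≤ ∫⁻ t, ((Icc a₁ b₁).indicator (fun _ => ENNReal.ofReal M₁) t +
        (Icc a₂ b₂).indicator (fun _ => ENNReal.ofReal M₂) t) := by
        apply lintegral_mono
        intro t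
        by_cases h0 : F t = 0
        · simp [h0]
        rcases h t h0 with ⟨h1, h2⟩ | ⟨h1, h2⟩
        · simp only [indicator_of_mem h1]; exact le_add_right h2
        · simp only [indicator_of_mem h1]; exact le_add_left h2
    _ = ENNReal.ofReal (M₁ * (b₁ - a₁)) + ENNReal.ofReal (M₂ * (b₂ - a₂)) := by
        rw [lintegral_add_left (by fun_prop (disch := measurability)),
          lintegral_indicator measurableSet_Icc,
          lintegral_indicator measurableSet_Icc]
        simp [ENNReal.ofReal_mul, hM₁, hM₂]
    _ ≤ ENNReal.ofReal C := by
        have h1 : 0 ≤ b₁ - a₁ := by linarith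
        have h2 : 0 ≤ b₂ - a₂ := by linarith
        rw [← ENNReal.ofReal_add (by positivity) (by positivity)]
        exact ENNReal.ofReal_le_ofReal hC

lemma oneA (R σ lam : ℝ) (hR : 0 < R) (hl : 0 < lam) (F : ℝ → ℝ≥0∞)
    (h : ∀ u, F u ≠ 0 → 0 < u ∧ |u^2 * R^2 + 2 * u * σ| ≤ 3 * lam ∧
      F u ≤ ENNReal.ofReal (R^2 * u)) : ∫⁻ u, F u ≤ ENNReal.ofReal (22 * lam) := by
  set s : ℝ := 2 * |σ| / R with hs
  have hs0 : 0 ≤ s := by positivity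
  have hq : 0 < √(12 * lam) := Real.sqrt_pos.2 (by positivity)
  have hq2 : √(12 * lam) ^ 2 = 12 * lam := Real.sq_sqrt (by positivity)
  refine lint_two F 0 (√(12 * lam) / R) (R * √(12 * lam))
    ((s - 15 * lam / (4 * s)) / R) ((s + 15 * lam / (4 * s)) / R)
    (R * (4 * s / 3)) _ (by positivity) (by positivity) (by positivity) ?_ ?_ ?_
  · have : 0 ≤ 15 * lam / (4 * s) := by positivity
    gcongr
    linarith
  · intro u hu
    obtain ⟨hu0, hK, hF⟩ := h u hu
    by_cases h1 : u * R ≤ √(12 * lam)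
    · left
      refine ⟨⟨hu0.le, by rwa [le_div_iff₀ hR]⟩, hF.trans (ENNReal.ofReal_le_ofReal ?_)⟩
      nlinarith
    · right
      push Not at h1
      set v := u * R with hv
      have hv0 : 0 < v := by positivity
      have hv2 : 12 * lam < v ^ 2 := by rw [← hq2]; gcongr
      have hK2 : |v * (v + 2 * σ / R)| ≤ 3 * lam := by
        have : v * (v + 2 * σ / R) = u^2 * R^2 + 2 * u * σ := by rw [hv]; field_simp
        rwa [this]
      have hsig : 2 * σ / R = s ∨ 2 * σ / R = -s := by
        rcases abs_cases σ with ⟨h, _⟩ | ⟨h, _⟩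
        · left; rw [hs, h]
        · right; rw [hs, h]; ring
      rw [abs_le] at hK2
      have hneg : 2 * σ / R = -s := by
        rcases hsig with h | h
        · exfalso; rw [h] at hK2; nlinarith
        · exact h
      rw [hneg] at hK2
      have hb1 : 3 * v / 4 ≤ s := by
        by_contra hc; push Not at hc; nlinarith
      have hb2 : s ≤ 5 * v / 4 := by
        by_contra hc; push Not at hc; nlinarith
      have hs1 : 0 < s := by linarith
      have hd : |v - s| ≤ 15 * lam / (4 * s) := by
        rw [le_div_iff₀ (by positivity)]
        have h5 : |v - s| * v ≤ 3 * lam := by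
          rw [← abs_of_pos hv0, ← abs_mul, abs_of_pos hv0, abs_le]
          constructor <;> nlinarith
        nlinarith [abs_nonneg (v - s)]
      rw [abs_le] at hd
      refine ⟨⟨?_, ?_⟩, hF.trans (ENNReal.ofReal_le_ofReal ?_)⟩
      · rw [div_le_iff₀ hR]; linarith
      · rw [le_div_iff₀ hR]; linarith
      · have : R^2 * u = R * v := by rw [hv]; ring
        rw [this]; gcongr; linarith
  · have e1 : R * √(12 * lam) * (√(12 * lam) / R - 0) = 12 * lam := by
      calc R * √(12 * lam) * (√(12 * lam) / R - 0) = √(12 * lam) ^ 2 := by field_simp; ring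
        _ = _ := hq2
    rw [e1]
    rcases hs0.eq_or_lt with h0 | h0
    · rw [← h0]; simp; linarith
    · have : R * (4 * s / 3) * ((s + 15 * lam / (4 * s)) / R - (s - 15 * lam / (4 * s)) / R)
        = 10 * lam := by field_simp; ring
      rw [this]; linarith

lemma incrB (h₀ t₁ t₂ P Q : ℝ) (hP : 0 ≤ P)
    (hh₁ : 0 < h₀ - t₁) (hh₂ : 0 < h₀ - t₂)
    (hA₁ : t₁^2 + Q ≤ ((h₀ - t₁)^2 + P) / 100) (hA₂ : t₂^2 + Q ≤ ((h₀ - t₂)^2 + P) / 100)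
    (hQ : 0 ≤ Q)
    (hN : (h₀ - t₂)^2 + P ≤ 3/2 * ((h₀ - t₁)^2 + P)) :
    |t₂ - t₁| ≤ |(2 * t₂ + (h₀ - t₂) / ((h₀ - t₂)^2 + P) * (t₂^2 + Q)) -
      (2 * t₁ + (h₀ - t₁) / ((h₀ - t₁)^2 + P) * (t₁^2 + Q))| := by
  set h₁ := h₀ - t₁ with hh1
  set h₂ := h₀ - t₂ with hh2
  set N₁ := h₁^2 + P with hN1
  set N₂ := h₂^2 + P with hN2
  have hN1p : 0 < N₁ := by positivity
  have hN2p : 0 < N₂ := by positivity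
  have hΔ : t₂ - t₁ = h₁ - h₂ := by rw [hh1, hh2]; ring
  have key : (2 * t₂ + h₂ / N₂ * (t₂^2 + Q)) - (2 * t₁ + h₁ / N₁ * (t₁^2 + Q)) =
      (t₂ - t₁) * (2 + (h₁ * h₂ - P) / N₁ * ((t₂^2 + Q) / N₂) + h₁ * (t₁ + t₂) / N₁) := by
    have e1 : h₂ / N₂ - h₁ / N₁ = (t₂ - t₁) * (h₁ * h₂ - P) / (N₁ * N₂) := by
      rw [div_sub_div _ _ hN2p.ne' hN1p.ne', hΔ, hN1, hN2]
      congr 1 <;> ring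
    have e2 : (2 * t₂ + h₂ / N₂ * (t₂^2 + Q)) - (2 * t₁ + h₁ / N₁ * (t₁^2 + Q)) =
      2 * (t₂ - t₁) + (h₂ / N₂ - h₁ / N₁) * (t₂^2 + Q) + h₁ / N₁ * (t₂^2 - t₁^2) := by ring
    rw [e2, e1]
    field_simp
    ring
  rw [key, abs_mul]
  have b1 : |(h₁ * h₂ - P) / N₁| ≤ 5/4 := by
    rw [abs_div, abs_of_pos hN1p, div_le_iff₀ hN1p, abs_le]
    constructor <;> nlinarith [mul_pos hh₁ hh₂, sq_nonneg (h₁ - h₂)]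
  have b2 : |(t₂^2 + Q) / N₂| ≤ 1/100 := by
    rw [abs_of_nonneg (by positivity), div_le_iff₀ hN2p]; linarith
  have b3 : |h₁ * (t₁ + t₂) / N₁| ≤ 1/4 := by
    rw [abs_div, abs_of_pos hN1p, div_le_iff₀ hN1p, abs_le]
    constructor <;> nlinarith [sq_nonneg (h₁ - 10 * t₁), sq_nonneg (h₁ - 10 * t₂),
      sq_nonneg (h₁ + 10 * t₁), sq_nonneg (h₁ + 10 * t₂)]
  have b4 : |(h₁ * h₂ - P) / N₁ * ((t₂^2 + Q) / N₂)| ≤ 5/4 * (1/100) := by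
    rw [abs_mul]; gcongr
  rw [abs_le] at b3 b4
  have b5 : 1 ≤ |2 + (h₁ * h₂ - P) / N₁ * ((t₂^2 + Q) / N₂) + h₁ * (t₁ + t₂) / N₁| := by
    refine le_trans ?_ (le_abs_self _)
    linarith [b3.1, b4.1]
  nlinarith [abs_nonneg (t₂ - t₁)]

lemma oneB (h₀ P Q Z lam : ℝ) (hP : 0 ≤ P) (hQ : 0 ≤ Q) (hZ : 0 < Z) (hl : 0 < lam) (F : ℝ → ℝ≥0∞)
    (h : ∀ t, F t ≠ 0 → 0 < h₀ - t ∧ t^2 + Q ≤ ((h₀ - t)^2 + P) / 100 ∧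
      81/100 * ((h₀ - t)^2 + P) ≤ Z ∧ Z ≤ 121/100 * ((h₀ - t)^2 + P) ∧
      |((h₀ - t) / ((h₀ - t)^2 + P))^2 * (t^2 + Q) + 2 * ((h₀ - t) / ((h₀ - t)^2 + P)) * t| ≤ 3 * lam ∧
      F t ≤ ENNReal.ofReal ((h₀ - t) / ((h₀ - t)^2 + P))) :
    ∫⁻ t, F t ≤ ENNReal.ofReal (80 * lam) := by
  set M := √(25 * lam * Z) with hM
  have hM0 : 0 ≤ M := Real.sqrt_nonneg _
  have hM2 : M ^ 2 = 25 * lam * Z := Real.sq_sqrt (by positivity)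
  -- second type
  have type2 : ∀ t, F t ≠ 0 → (h₀ - t) / 10 < |t| →
      t ∈ Icc (h₀ - M) h₀ ∧ F t ≤ ENNReal.ofReal (5/4 * M / Z) := by
    intro t ht ht2
    obtain ⟨h1, h2, h3, h4, h5, h6⟩ := h t ht
    set H := h₀ - t with hH
    set N := H^2 + P with hN
    have hNp : 0 < N := by positivity
    set u := H / N with hu
    have hup : 0 < u := by positivity
    have hA : u * (t^2 + Q) ≤ |t| / 10 := by
      have : u * (t^2 + Q) ≤ u * (N / 100) := by gcongr
      have e : u * (N / 100) = H / 100 := by rw [hu]; field_simp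
      linarith
    have hA0 : 0 ≤ u * (t^2 + Q) := by positivity
    have h7 : u * |t| * (19/10) ≤ 3 * lam := by
      refine le_trans ?_ h5
      have e : u^2 * (t^2 + Q) + 2 * u * t = u * (u * (t^2 + Q) + 2 * t) := by ring
      rw [e, abs_mul, abs_of_pos hup, mul_assoc]
      gcongr
      rcases abs_cases t with ⟨ha, hb⟩ | ⟨ha, hb⟩
      · exact le_trans (by linarith) (le_abs_self _)
      · exact le_trans (by linarith) (neg_le_abs _)
    have h8 : H ^ 2 ≤ 20 * lam * N := by
      have e : u * |t| * N = H * |t| := by rw [hu]; field_simp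
      have : H * |t| * (19/10) ≤ 3 * lam * N := by
        rw [← e]; nlinarith
      have : H * (H / 10) ≤ H * |t| := by gcongr
      nlinarith [mul_pos hl hNp]
    have h9 : H ≤ M := by
      apply Real.le_sqrt_of_sq_le
      nlinarith [mul_pos hl hNp]
    refine ⟨⟨by linarith, by linarith⟩, h6.trans (ENNReal.ofReal_le_ofReal ?_)⟩
    rw [hu, div_le_div_iff₀ hNp hZ]
    calc H * Z ≤ M * (121/100 * N) := by gcongr
      _ ≤ _ := by nlinarith [mul_nonneg hM0 hNp.le]
  by_cases hne : ∃ t₁, F t₁ ≠ 0 ∧ |t₁| ≤ (h₀ - t₁) / 10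
  · obtain ⟨t₁, ht₁, hs₁⟩ := hne
    have type1 : ∀ t, F t ≠ 0 → |t| ≤ (h₀ - t) / 10 → 0 < h₀ ∧
        (h₀ - t) / ((h₀ - t)^2 + P) ≤ 2 * (h₀ / Z) ∧
        |2 * t + (h₀ - t) / ((h₀ - t)^2 + P) * (t^2 + Q)| ≤ 6 * lam / (h₀ / Z) := by
      intro t ht ht2
      obtain ⟨h1, h2, h3, h4, h5, h6⟩ := h t ht
      set H := h₀ - t with hH
      set N := H^2 + P with hN
      have hNp : 0 < N := by positivity
      set u := H / N with hu
      have hup : 0 < u := by positivity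
      rw [abs_le] at ht2
      have hh0 : h₀ = H + t := by rw [hH]; ring
      have hh1 : 9/10 * H ≤ h₀ := by linarith
      have hh2 : h₀ ≤ 11/10 * H := by linarith
      have hh3 : 0 < h₀ := by linarith
      refine ⟨hh3, ?_, ?_⟩
      · rw [hu, ← mul_div_assoc, div_le_div_iff₀ hNp hZ]
        calc H * Z ≤ H * (121/100 * N) := by gcongr
          _ ≤ _ := by nlinarith
      · have hul : h₀ / Z ≤ 2 * u := by
          rw [hu, ← mul_div_assoc, div_le_div_iff₀ hZ hNp]
          calc h₀ * N ≤ 11/10 * H * (Z / (81/100)) := by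
                gcongr
                rw [le_div_iff₀ (by norm_num)]; linarith
            _ ≤ _ := by nlinarith [mul_pos h1 hZ]
        rw [le_div_iff₀ (by positivity)]
        have e : u * |2 * t + u * (t^2 + Q)| ≤ 3 * lam := by
          rw [← abs_of_pos hup, ← abs_mul, abs_of_pos hup]
          have e1 : u * (2 * t + u * (t^2 + Q)) = u^2 * (t^2 + Q) + 2 * u * t := by ring
          rw [e1]; exact h5
        calc |2 * t + u * (t^2 + Q)| * (h₀ / Z) ≤ |2 * t + u * (t^2 + Q)| * (2 * u) := by gcongr
          _ ≤ _ := by linarith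
    obtain ⟨hh0, -, hb₁⟩ := type1 t₁ ht₁ hs₁
    set u₀ := h₀ / Z with hu0
    have hu0p : 0 < u₀ := by positivity
    have hd0 : 0 < 12 * lam / u₀ := by positivity
    refine lint_two F (t₁ - 12 * lam / u₀) (t₁ + 12 * lam / u₀) (2 * u₀) (h₀ - M) h₀ (5/4 * M / Z) _
      (by positivity) (by positivity) (by linarith) (by linarith) ?_ ?_
    · intro t ht
      by_cases hs : |t| ≤ (h₀ - t) / 10
      · left
        obtain ⟨-, hu, hb⟩ := type1 t ht hs
        obtain ⟨h1, h2, h3, h4, h5, h6⟩ := h t ht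
        obtain ⟨h1', h2', h3', h4', h5', h6'⟩ := h t₁ ht₁
        refine ⟨?_, h6.trans (ENNReal.ofReal_le_ofReal hu)⟩
        have := incrB h₀ t₁ t P Q hP h1' h1 h2' h2 hQ (by nlinarith)
        have h7 := this.trans (abs_sub _ _)
        have h8 : |t - t₁| ≤ 12 * lam / u₀ := by
          refine h7.trans ?_
          have : 12 * lam / u₀ = 6 * lam / u₀ + 6 * lam / u₀ := by ring
          linarith
        rw [abs_le] at h8
        constructor <;> linarith
      · right
        exact type2 t ht (not_le.1 hs)
    · have e1 : 2 * u₀ * (t₁ + 12 * lam / u₀ - (t₁ - 12 * lam / u₀)) = 48 * lam := by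
        field_simp; ring
      have e2 : 5/4 * M / Z * (h₀ - (h₀ - M)) = 5/4 * M^2 / Z := by ring
      rw [e1, e2, hM2]
      have e3 : 5/4 * (25 * lam * Z) / Z = 125/4 * lam := by field_simp; norm_num
      rw [e3]; linarith
  · push Not at hne
    refine lint_two F 0 0 0 (h₀ - M) h₀ (5/4 * M / Z) _
      (by positivity) (by positivity) (by linarith) (by linarith) ?_ ?_
    · intro t ht
      exact Or.inr (type2 t ht (hne t ht))
    · have e2 : 5/4 * M / Z * (h₀ - (h₀ - M)) = 5/4 * M^2 / Z := by ring
      rw [e2, hM2]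
      have e3 : 5/4 * (25 * lam * Z) / Z = 125/4 * lam := by field_simp; norm_num
      rw [e3]; linarith

lemma lint_inv (m : ℕ) (G : En (m+1) → ℝ≥0∞) :
    ∫⁻ η, G η = ∫⁻ y : En (m+1), ENNReal.ofReal (((‖y‖^2)⁻¹)^(m+1)) * G ((‖y‖^2)⁻¹ • y) := by
  have hnull : ∀ᵐ y : En (m+1), y ∈ ({0} : Set (En (m+1)))ᶜ := by
    exact compl_mem_ae_iff.2 (by simp)
  have hinv : ∀ y : En (m+1), EuclideanGeometry.inversion (0 : En (m+1)) 1 y = (‖y‖^2)⁻¹ • y := by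
    intro y
    simp [EuclideanGeometry.inversion_def]
  have himg : EuclideanGeometry.inversion (0 : En (m+1)) 1 '' ({0}ᶜ : Set (En (m+1))) = {0}ᶜ := by
    ext y
    constructor
    · rintro ⟨x, hx, rfl⟩
      simpa [EuclideanGeometry.inversion_eq_center] using hx
    · intro hy
      refine ⟨EuclideanGeometry.inversion (0 : En (m+1)) 1 y, ?_, ?_⟩
      · simpa [EuclideanGeometry.inversion_eq_center] using hy
      · exact EuclideanGeometry.inversion_inversion _ one_ne_zero _
  have h := lintegral_image_eq_lintegral_abs_det_fderiv_mul (volume : Measure (En (m+1)))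
    (s := ({0}ᶜ : Set (En (m+1)))) (f := EuclideanGeometry.inversion (0 : En (m+1)) 1)
    (measurableSet_singleton 0).compl
    (fun x hx => (EuclideanGeometry.hasFDerivAt_inversion (R := 1) (by simpa using hx)).hasFDerivWithinAt)
    ((EuclideanGeometry.inversion_injective _ one_ne_zero).injOn) G
  rw [himg, Measure.restrict_eq_self_of_ae_mem hnull] at h
  rw [h]
  apply lintegral_congr
  intro y
  rw [hinv]
  congr 2
  have h1 : ∀ (c : ℝ) (L : En (m+1) →L[ℝ] En (m+1)), (c • L).det = c^(m+1) * L.det := by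
    intro c L
    have := LinearMap.det_smul c (L : En (m+1) →ₗ[ℝ] En (m+1))
    rw [finrank_euclideanSpace_fin] at this
    exact this
  rw [h1, abs_mul]
  have h2 : |((ℝ ∙ (y - 0))ᗮ.reflection : En (m+1) →L[ℝ] En (m+1)).det| = 1 := by
    have := Submodule.det_reflection ((ℝ ∙ (y - 0))ᗮ)
    have h3 : ((ℝ ∙ (y - 0))ᗮ.reflection : En (m+1) →L[ℝ] En (m+1)).det =
      LinearMap.det ((ℝ ∙ (y - 0))ᗮ.reflection).toLinearMap := rfl
    rw [h3, this, abs_pow]; simp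
  rw [h2, mul_one, abs_of_nonneg (by positivity)]
  simp

/-- `u = 1/k`. -/
def ufun {n : ℕ} (θ η : En n) : ℝ := -⟪θ, η⟫ / ‖η‖ ^ 2

/-- shell condition -/
def shellSet {n : ℕ} (θ : En n) (lam : ℝ) : Set (En n × En n) :=
  {p | ⟪θ, p.2⟫ < 0 ∧ 1 ≤ ‖p.2‖ ∧
    |(ufun θ p.2) ^ 2 * ‖p.1‖ ^ 2 + 2 * ufun θ p.2 * ⟪θ, p.1⟫| ≤ 3 * lam}

lemma meas_ufun {n : ℕ} (θ : En n) : Measurable (ufun θ) := by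
  unfold ufun; fun_prop

lemma meas_shellSet {n : ℕ} (θ : En n) (lam : ℝ) : MeasurableSet (shellSet θ lam) := by
  have h1 : Measurable (fun p : En n × En n => ufun θ p.2) := (meas_ufun θ).comp measurable_snd
  have e : shellSet θ lam = {p : En n × En n | ⟪θ, p.2⟫ < 0} ∩ ({p | 1 ≤ ‖p.2‖} ∩
    {p | |(ufun θ p.2) ^ 2 * ‖p.1‖ ^ 2 + 2 * ufun θ p.2 * ⟪θ, p.1⟫| ≤ 3 * lam}) := rfl
  rw [e]
  refine MeasurableSet.inter (measurableSet_lt (by fun_prop) (by fun_prop))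
    (MeasurableSet.inter (measurableSet_le (by fun_prop) (by fun_prop))
    (measurableSet_le (continuous_abs.measurable.comp ?_) (by fun_prop)))
  fun_prop

lemma meas_jap {n : ℕ} : Measurable (jap : En n → ℝ) := by
  unfold jap; fun_prop

lemma jap_ge_norm {n : ℕ} (x : En n) : ‖x‖ ≤ jap x := by
  unfold jap; apply Real.le_sqrt_of_sq_le; linarith
lemma jap_ge_one {n : ℕ} (x : En n) : 1 ≤ jap x := by
  unfold jap; apply Real.le_sqrt_of_sq_le; nlinarith [sq_nonneg ‖x‖]
lemma jap_pos {n : ℕ} (x : En n) : 0 < jap x := lt_of_lt_of_le one_pos (jap_ge_one x)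
lemma jap_sq {n : ℕ} (x : En n) : jap x ^ 2 = 1 + ‖x‖ ^ 2 := by
  unfold jap; exact Real.sq_sqrt (by positivity)

lemma jap_le_two {n : ℕ} (x : En n) (hx : 1 ≤ ‖x‖) : jap x ≤ 2 * ‖x‖ := by
  unfold jap; rw [Real.sqrt_le_left (by positivity)]; nlinarith

/-- the set for kernel A -/
def setA {n : ℕ} (θ : En n) (lam : ℝ) : Set (En n × En n) :=
  shellSet θ lam ∩ {p | ‖p.2‖ ≤ 10 * ‖p.1‖}

def setB {n : ℕ} (θ : En n) (lam : ℝ) : Set (En n × En n) :=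
  shellSet θ lam ∩ {p | 10 * ‖p.1‖ < ‖p.2‖}

lemma meas_setA {n : ℕ} (θ : En n) (lam : ℝ) : MeasurableSet (setA θ lam) :=
  (meas_shellSet θ lam).inter (measurableSet_le (by fun_prop) (by fun_prop))

lemma meas_setB {n : ℕ} (θ : En n) (lam : ℝ) : MeasurableSet (setB θ lam) :=
  (meas_shellSet θ lam).inter (measurableSet_lt (by fun_prop) (by fun_prop))

/-- kernel A, as function of the pair `(ξ, η)` -/
def kA {n : ℕ} (γ ε b : ℝ) (θ : En n) (lam : ℝ) : En n × En n → ℝ≥0∞ :=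
  (setA θ lam).indicator
    (fun p => ENNReal.ofReal (‖p.2‖ ^ γ * ufun θ p.2 ^ (3 - 2 * ε) * jap (p.2 - p.1) ^ (-b)))

def kB {n : ℕ} (γ ε b : ℝ) (θ : En n) (lam : ℝ) : En n × En n → ℝ≥0∞ :=
  (setB θ lam).indicator
    (fun p => ENNReal.ofReal (‖p.2‖ ^ γ * ufun θ p.2 ^ (3 - 2 * ε) * jap p.1 ^ (-b)))

lemma meas_kA {n : ℕ} (γ ε b : ℝ) (θ : En n) (lam : ℝ) : Measurable (kA γ ε b θ lam) := by
  refine Measurable.indicator ?_ (meas_setA θ lam)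
  have h1 : Measurable (fun p : En n × En n => ufun θ p.2) := (meas_ufun θ).comp measurable_snd
  have h2 : Measurable (fun p : En n × En n => jap (p.2 - p.1)) := meas_jap.comp (by fun_prop)
  fun_prop

lemma meas_kB {n : ℕ} (γ ε b : ℝ) (θ : En n) (lam : ℝ) : Measurable (kB γ ε b θ lam) := by
  refine Measurable.indicator ?_ (meas_setB θ lam)
  have h1 : Measurable (fun p : En n × En n => ufun θ p.2) := (meas_ufun θ).comp measurable_snd
  have h2 : Measurable (fun p : En n × En n => jap p.1) := meas_jap.comp (by fun_prop)
  fun_prop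

lemma split_norm {m : ℕ} (θ : En (m+1)) (hθ : ‖θ‖ = 1) (I : En m →ₗᵢ[ℝ] En (m+1))
    (hI : ∀ w, ⟪θ, I w⟫ = 0) (t : ℝ) (w : En m) :
    ‖t • θ + I w‖ ^ 2 = t ^ 2 + ‖w‖ ^ 2 ∧ ⟪θ, t • θ + I w⟫ = t := by
  constructor
  · rw [norm_add_sq_real, inner_smul_left, hI, norm_smul, hθ, I.norm_map]; simp
  · rw [inner_add_right, inner_smul_right, hI, real_inner_self_eq_norm_sq, hθ]; simp

lemma A_point {m : ℕ} (γ ε b lam : ℝ) (hb : 0 ≤ b)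
    (θ ξ : En (m+1)) (hθ : ‖θ‖ = 1) (hξ : ξ ≠ 0) (I : En m →ₗᵢ[ℝ] En (m+1))
    (hI : ∀ w, ⟪θ, I w⟫ = 0) (t : ℝ) (w : En m) (y η : En (m+1)) (hy : y = t • θ + I w)
    (hη : η = (‖y‖^2)⁻¹ • y)
    (w₀ : En m) (hw0 : w₀ = (I.toContinuousLinearMap.adjoint) ((‖ξ‖^2)⁻¹ • ξ)) (hw : w ≠ w₀)
    (h : (ξ, η) ∈ setA θ lam) :
    0 < -t ∧ -t ≤ 1 ∧ |(-t)^2 * ‖ξ‖^2 + 2 * (-t) * ⟪θ, ξ⟫| ≤ 3 * lam ∧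
    ((‖y‖^2)⁻¹)^(m+1) * (‖η‖^γ * ufun θ η^(3-2*ε) * jap (η - ξ)^(-b)) ≤
      100 * 10^b * ‖ξ‖^2 * (-t)^(3-2*ε) *
        (((-t)^2+‖w‖^2)^(-(γ + 2 * (m - b))/2) * ‖w-w₀‖^(-b)) := by
  obtain ⟨⟨h1, h2, h3⟩, h4⟩ := h
  simp only [mem_ofPred_eq] at h1 h2 h3 h4
  have hy0 : y ≠ 0 := by
    rintro rfl; simp [hη] at h1
  have hyn : 0 < ‖y‖ := norm_pos_iff.2 hy0
  obtain ⟨hN, hin⟩ := split_norm θ hθ I hI t w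
  rw [← hy] at hN hin
  have hηn : ‖η‖ = ‖y‖⁻¹ := by
    rw [hη, norm_smul, norm_inv, norm_pow, norm_norm]; field_simp
  have hηi : ⟪θ, η⟫ = t / ‖y‖^2 := by
    rw [hη, inner_smul_right, hin]; field_simp
  have hu : ufun θ η = -t := by
    unfold ufun; rw [hηi, hηn]; field_simp
  rw [hu] at h3
  have ht : 0 < -t := by
    rw [hηi] at h1
    by_contra hc
    have : 0 ≤ t / ‖y‖^2 := div_nonneg (by linarith) (by positivity)
    linarith
  have hy1 : ‖y‖ ≤ 1 := by
    rw [hηn] at h2; exact (one_le_inv₀ hyn).1 h2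
  have ht1 : -t ≤ 1 := by nlinarith [sq_nonneg ‖w‖]
  refine ⟨ht, ht1, h3, ?_⟩
  have hξn : 0 < ‖ξ‖ := norm_pos_iff.2 hξ
  -- distance
  set x := (‖ξ‖^2)⁻¹ • ξ with hx
  have hx0 : x ≠ 0 := by simp [hx, hξ]
  have hxn : ‖x‖ = ‖ξ‖⁻¹ := by
    rw [hx, norm_smul, norm_inv, norm_pow, norm_norm]; field_simp
  have hxi : ξ = (‖x‖^2)⁻¹ • x := by
    rw [hxn, hx, smul_smul]; field_simp; simp
  have hdist : ‖η - ξ‖ = (‖y‖ * ‖x‖)⁻¹ * ‖y - x‖ := by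
    have := dist_div_norm_sq_smul hy0 hx0 1
    simp only [dist_eq_norm, one_div, inv_pow, one_pow] at this
    rw [← hη, ← hxi] at this
    exact this
  have hproj : ‖w - w₀‖ ≤ ‖y - x‖ := by
    have e1 : (I.toContinuousLinearMap.adjoint) (y - x) = w - w₀ := by
      rw [map_sub, ← hw0]
      congr 1
      apply ext_inner_right ℝ
      intro v
      rw [ContinuousLinearMap.adjoint_inner_left, hy]
      simp only [LinearIsometry.coe_toContinuousLinearMap]
      rw [inner_add_left, inner_smul_left, hI, I.inner_map_map]; simp
    rw [← e1]
    refine (ContinuousLinearMap.le_opNorm _ _).trans ?_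
    have : ‖I.toContinuousLinearMap.adjoint‖ ≤ 1 := by
      rw [LinearIsometryEquiv.norm_map]
      exact I.norm_toContinuousLinearMap_le
    exact (mul_le_mul_of_nonneg_right this (norm_nonneg _)).trans (by simp)
  have hww : 0 < ‖w - w₀‖ := norm_pos_iff.2 (sub_ne_zero.2 hw)
  have hxy : ‖x‖ ≤ 10 * ‖y‖ := by
    rw [hηn] at h4
    rw [hxn, inv_le_iff_one_le_mul₀ hξn]
    have := mul_le_mul_of_nonneg_left h4 hyn.le
    rw [mul_inv_cancel₀ hyn.ne'] at this
    linarith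
  have hlow : ‖w - w₀‖ / (10 * ‖y‖^2) ≤ jap (η - ξ) := by
    refine le_trans ?_ (jap_ge_norm _)
    rw [hdist, inv_mul_eq_div]
    have : ‖y‖ * ‖x‖ ≤ 10 * ‖y‖^2 := by nlinarith
    have hxp : 0 < ‖x‖ := norm_pos_iff.2 hx0
    gcongr
  have hj : jap (η - ξ) ^ (-b) ≤ 10 ^ b * (‖y‖^2) ^ b * ‖w - w₀‖ ^ (-b) := by
    calc jap (η - ξ) ^ (-b) ≤ (‖w - w₀‖ / (10 * ‖y‖^2)) ^ (-b) :=
          Real.rpow_le_rpow_of_nonpos (by positivity) hlow (by linarith)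
      _ = _ := by
          rw [div_eq_mul_inv, Real.mul_rpow (by positivity) (by positivity),
            Real.inv_rpow (by positivity), Real.rpow_neg (x := 10 * ‖y‖^2) (by positivity), inv_inv,
            Real.mul_rpow (by positivity) (by positivity)]
          ring
  rw [hu]
  have hN' : (-t)^2 + ‖w‖^2 = ‖y‖^2 := by rw [hN]; ring
  rw [hN']
  have e1 : ‖η‖^γ = (‖y‖^2)^(-γ/2) := by
    rw [hηn, Real.inv_rpow hyn.le, ← Real.rpow_neg hyn.le, ← Real.rpow_natCast ‖y‖ 2,
      ← Real.rpow_mul hyn.le]; congr 1; push_cast; ring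
  have e2 : ((‖y‖^2)⁻¹)^(m+1) = (‖y‖^2)^(-((m:ℝ)+1)) := by
    rw [Real.rpow_neg (by positivity), inv_pow, ← Real.rpow_natCast (‖y‖^2)]; push_cast; rfl
  have e3 : (‖y‖^2)^(-((m:ℝ)+1)) * (‖y‖^2)^(-γ/2) * (‖y‖^2)^b =
      (‖y‖^2)⁻¹ * (‖y‖^2)^(-(γ + 2 * (m - b))/2) := by
    rw [← Real.rpow_neg_one (‖y‖^2), ← Real.rpow_add (by positivity), ← Real.rpow_add (by positivity),
      ← Real.rpow_add (by positivity)]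
    congr 1; ring
  have h5 : (‖y‖^2)⁻¹ ≤ 100 * ‖ξ‖^2 := by
    rw [hηn] at h4
    rw [← inv_pow]
    have : (0:ℝ) ≤ ‖y‖⁻¹ := by positivity
    nlinarith
  rw [e1, e2]
  have ht3 : 0 ≤ (-t)^(3-2*ε) := Real.rpow_nonneg ht.le _
  calc (‖y‖^2)^(-((m:ℝ)+1)) * ((‖y‖^2)^(-γ/2) * (-t)^(3-2*ε) * jap (η - ξ)^(-b))
      ≤ (‖y‖^2)^(-((m:ℝ)+1)) * ((‖y‖^2)^(-γ/2) * (-t)^(3-2*ε) *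
        (10 ^ b * (‖y‖^2) ^ b * ‖w - w₀‖ ^ (-b))) := by gcongr
    _ = ((‖y‖^2)^(-((m:ℝ)+1)) * (‖y‖^2)^(-γ/2) * (‖y‖^2)^b) * ((-t)^(3-2*ε) * 10^b * ‖w - w₀‖ ^ (-b)) := by
        ring
    _ = (‖y‖^2)⁻¹ * ((‖y‖^2)^(-(γ + 2 * (m - b))/2) * ((-t)^(3-2*ε) * 10^b * ‖w - w₀‖ ^ (-b))) := by
        rw [e3]; ring
    _ ≤ (100 * ‖ξ‖^2) * ((‖y‖^2)^(-(γ + 2 * (m - b))/2) * ((-t)^(3-2*ε) * 10^b * ‖w - w₀‖ ^ (-b))) := by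
        gcongr
    _ = _ := by ring

lemma kernelA (m : ℕ) (hm : 1 ≤ m) (γ ε b : ℝ) (hγ : 0 ≤ γ) (hb : 0 ≤ b) (hbm : b < m)
    (hs : γ + (m - b) ≤ 2 - 2 * ε) :
    ∃ K : ℝ≥0∞, K ≠ ⊤ ∧ ∀ θ : En (m+1), ‖θ‖ = 1 → ∀ lam : ℝ, 0 < lam → ∀ ξ : En (m+1),
      ∫⁻ η, kA γ ε b θ lam (ξ, η) ≤ K * ENNReal.ofReal lam := by
  set p := γ + 2 * (m - b) with hp
  have hp0 : 0 ≤ p := by linarith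
  have hkf := kern_finite m hm p b hp0 hbm (by linarith)
  set c0 : ℝ := 100 * 10^b with hc0
  have hc0p : 0 < c0 := by positivity
  set K1 : ℝ≥0∞ := ENNReal.ofReal c0 * ENNReal.ofReal (1+2^(p/2)) * kern m p b 1 with hK1
  have hK1f : K1 ≠ ⊤ := by
    rw [hK1]; exact ENNReal.mul_ne_top (ENNReal.mul_ne_top ENNReal.ofReal_ne_top ENNReal.ofReal_ne_top) hkf.ne
  refine ⟨K1 * ENNReal.ofReal 22, ENNReal.mul_ne_top hK1f ENNReal.ofReal_ne_top, ?_⟩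
  intro θ hθ lam hlam ξ
  by_cases hξ : ξ = 0
  · have : ∀ η, kA γ ε b θ lam (ξ, η) = 0 := by
      intro η
      apply indicator_of_notMem
      rintro ⟨⟨h1, h2, h3⟩, h4⟩
      simp only [mem_ofPred_eq, hξ, norm_zero] at h2 h4
      linarith
    simp [this]
  obtain ⟨I, hI, hsplit⟩ := exists_split m θ hθ
  set w₀ := (I.toContinuousLinearMap.adjoint) ((‖ξ‖^2)⁻¹ • ξ) with hw0
  set F0 : ℝ → ℝ≥0∞ := {u : ℝ | 0 < u ∧ |u^2 * ‖ξ‖^2 + 2 * u * ⟪θ, ξ⟫| ≤ 3 * lam}.indicator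
    (fun u => ENNReal.ofReal (‖ξ‖^2 * u)) with hF0
  have hF0i : ∫⁻ u, F0 u ≤ ENNReal.ofReal (22 * lam) := by
    apply oneA ‖ξ‖ ⟪θ, ξ⟫ lam (norm_pos_iff.2 hξ) hlam
    intro u hu
    have hmem := mem_of_indicator_ne_zero hu
    exact ⟨hmem.1, hmem.2, by rw [hF0, indicator_of_mem hmem]⟩
  have hmk := meas_kA γ ε b θ lam
  rw [lint_inv, hsplit _ (by fun_prop)]
  have hwae : ∀ᵐ w : En m, w ≠ w₀ := by
    have : Nonempty (Fin m) := ⟨⟨0, hm⟩⟩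
    have : Nontrivial (En m) := inferInstance
    exact compl_mem_ae_iff.2 (measure_singleton w₀)
  have inner : ∀ t : ℝ, ∫⁻ w : En m, ENNReal.ofReal (((‖t • θ + I w‖^2)⁻¹)^(m+1)) *
      kA γ ε b θ lam (ξ, (‖t • θ + I w‖^2)⁻¹ • (t • θ + I w)) ≤ K1 * F0 (-t) := by
    intro t
    by_cases hD : 0 < -t ∧ -t ≤ 1 ∧ |(-t)^2 * ‖ξ‖^2 + 2 * (-t) * ⟪θ, ξ⟫| ≤ 3 * lam
    · calc _ ≤ ∫⁻ w : En m, ENNReal.ofReal (c0 * ‖ξ‖^2 * (-t)^(3-2*ε)) *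
            ENNReal.ofReal (((-t)^2+‖w‖^2)^(-p/2) * ‖w-w₀‖^(-b)) := by
            apply lintegral_mono_ae
            filter_upwards [hwae] with w hw
            by_cases hmem : (ξ, (‖t • θ + I w‖^2)⁻¹ • (t • θ + I w)) ∈ setA θ lam
            · rw [kA, indicator_of_mem hmem, ← ENNReal.ofReal_mul (by positivity),
                ← ENNReal.ofReal_mul (mul_nonneg (by positivity) (Real.rpow_nonneg hD.1.le _))]
              apply ENNReal.ofReal_le_ofReal
              exact (A_point γ ε b lam hb θ ξ hθ hξ I hI t w _ _ rfl rfl w₀ hw0 hw hmem).2.2.2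
            · rw [kA, indicator_of_notMem hmem]; simp
        _ ≤ ENNReal.ofReal (c0 * ‖ξ‖^2 * (-t)^(3-2*ε)) *
            (ENNReal.ofReal (1+2^(p/2)) * (ENNReal.ofReal ((-t)^((m:ℝ)-p-b)) * kern m p b 1)) := by
            rw [lintegral_const_mul' _ _ ENNReal.ofReal_ne_top, ← kern_scale m p b (-t) hD.1]
            gcongr
            exact kern_shift m p b (-t) hD.1 hp0 hb hm w₀
        _ = K1 * (ENNReal.ofReal (‖ξ‖^2 * (-t)^(3-2*ε)) * ENNReal.ofReal ((-t)^((m:ℝ)-p-b))) := by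
            rw [mul_assoc c0, ENNReal.ofReal_mul hc0p.le, hK1]; ring
        _ ≤ K1 * F0 (-t) := by
            gcongr
            have hmem : -t ∈ {u : ℝ | 0 < u ∧ |u^2 * ‖ξ‖^2 + 2 * u * ⟪θ, ξ⟫| ≤ 3 * lam} :=
              ⟨hD.1, hD.2.2⟩
            rw [hF0, indicator_of_mem hmem,
              ← ENNReal.ofReal_mul (mul_nonneg (by positivity) (Real.rpow_nonneg hD.1.le _))]
            apply ENNReal.ofReal_le_ofReal
            rw [mul_assoc, ← Real.rpow_add hD.1]
            gcongr
            calc (-t) ^ _ ≤ (-t)^(1:ℝ) :=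
                  Real.rpow_le_rpow_of_exponent_ge hD.1 hD.2.1 (by linarith)
              _ = -t := Real.rpow_one _
    · refine le_trans (le_of_eq ?_) bot_le
      have hz : ∀ᵐ w : En m, ENNReal.ofReal (((‖t • θ + I w‖^2)⁻¹)^(m+1)) *
        kA γ ε b θ lam (ξ, (‖t • θ + I w‖^2)⁻¹ • (t • θ + I w)) = 0 := by
        filter_upwards [hwae] with w hw
        by_cases hmem : (ξ, (‖t • θ + I w‖^2)⁻¹ • (t • θ + I w)) ∈ setA θ lam
        · have := A_point γ ε b lam hb θ ξ hθ hξ I hI t w _ _ rfl rfl w₀ hw0 hw hmem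
          exact absurd ⟨this.1, this.2.1, this.2.2.1⟩ hD
        · rw [kA, indicator_of_notMem hmem]; simp
      rw [lintegral_congr_ae hz]; simp
  calc _ ≤ ∫⁻ t : ℝ, K1 * F0 (-t) := lintegral_mono inner
    _ = K1 * ∫⁻ t : ℝ, F0 t := by
        rw [lintegral_const_mul' _ _ hK1f, lintegral_neg_eq_self]
    _ ≤ K1 * ENNReal.ofReal (22 * lam) := by gcongr
    _ = _ := by rw [ENNReal.ofReal_mul (by norm_num)]; ring

lemma B_point {m : ℕ} (γ ε b lam : ℝ) (hb : 0 ≤ b) (he : 0 ≤ 2 - 2 * ε) (heγ : γ + 2 * ε - 2 ≤ 0)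
    (θ ζ : En (m+1)) (hθ : ‖θ‖ = 1) (I : En m →ₗᵢ[ℝ] En (m+1))
    (hI : ∀ w, ⟪θ, I w⟫ = 0) (t : ℝ) (w : En m) (ξ η : En (m+1)) (hξ : ξ = t • θ + I w)
    (hη : η = ζ + ξ) (hw : w ≠ 0) (h₀ P : ℝ) (hh₀ : h₀ = -⟪θ, ζ⟫)
    (hP : P = ‖ζ - ⟪θ, ζ⟫ • θ + I w‖^2)
    (h : (ξ, η) ∈ setB θ lam) :
    ufun θ η = (h₀ - t) / ((h₀ - t)^2 + P) ∧
    (0 < h₀ - t ∧ t^2 + ‖w‖^2 ≤ ((h₀ - t)^2 + P) / 100 ∧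
      81/100 * ((h₀ - t)^2 + P) ≤ ‖ζ‖^2 ∧ ‖ζ‖^2 ≤ 121/100 * ((h₀ - t)^2 + P) ∧
      |((h₀ - t) / ((h₀ - t)^2 + P))^2 * (t^2 + ‖w‖^2) + 2 * ((h₀ - t) / ((h₀ - t)^2 + P)) * t| ≤ 3 * lam) ∧
    ‖w‖ ≤ ‖ζ‖ ∧ 9/10 ≤ ‖ζ‖ ∧ 0 < ufun θ η ∧
    ‖η‖^γ * ufun θ η^(3-2*ε) * jap ξ^(-b) ≤ (‖ζ‖/2)^(γ+2*ε-2) * ‖w‖^(-b) * ufun θ η := by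
  obtain ⟨⟨h1, h2, h3⟩, h4⟩ := h
  simp only [mem_ofPred_eq] at h1 h2 h3 h4
  obtain ⟨hQ, hin⟩ := split_norm θ hθ I hI t w
  rw [← hξ] at hQ hin
  have hηi : ⟪θ, η⟫ = -(h₀ - t) := by
    rw [hη, inner_add_right, hin, hh₀]; ring
  have hN : ‖η‖^2 = (h₀ - t)^2 + P := by
    have e : η = (-(h₀ - t)) • θ + (ζ - ⟪θ, ζ⟫ • θ + I w) := by
      rw [hη, hξ, hh₀]; module
    have e2 : ⟪θ, ζ - ⟪θ, ζ⟫ • θ + I w⟫ = 0 := by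
      rw [inner_add_right, inner_sub_right, inner_smul_right, hI, real_inner_self_eq_norm_sq, hθ]; simp
    rw [e, norm_add_sq_real, inner_smul_left, e2, norm_smul, hθ, hP]; simp; ring
  have hηp : 0 < ‖η‖ := by linarith
  have hpos : 0 < h₀ - t := by rw [hηi] at h1; linarith
  have hu : ufun θ η = (h₀ - t) / ((h₀ - t)^2 + P) := by
    unfold ufun; rw [hηi, hN]; simp
  have hup : 0 < ufun θ η := by
    unfold ufun; rw [hηi]; simp only [neg_neg]; positivity
  have htri1 : ‖η‖ ≤ ‖ζ‖ + ‖ξ‖ := by rw [hη]; exact norm_add_le _ _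
  have htri2 : ‖ζ‖ ≤ ‖η‖ + ‖ξ‖ := by
    have : ζ = η - ξ := by rw [hη]; simp
    rw [this]; exact norm_sub_le _ _
  have hξ0 := norm_nonneg ξ
  have hζ0 := norm_nonneg ζ
  have hwξ : ‖w‖ ≤ ‖ξ‖ := by
    apply le_of_sq_le_sq _ hξ0
    rw [hQ]; nlinarith [sq_nonneg t]
  refine ⟨hu, ⟨hpos, ?_, ?_, ?_, ?_⟩, by linarith, by linarith, hup, ?_⟩
  · rw [← hQ, ← hN]; nlinarith
  · rw [← hN]; nlinarith
  · rw [← hN]; nlinarith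
  · rw [← hu, ← hQ]; rw [hin] at h3; exact h3
  have hwp : 0 < ‖w‖ := norm_pos_iff.2 hw
  have hj : jap ξ ^ (-b) ≤ ‖w‖^(-b) :=
    Real.rpow_le_rpow_of_nonpos hwp (hwξ.trans (jap_ge_norm ξ)) (by linarith)
  have hu1 : ufun θ η ≤ ‖η‖⁻¹ := by
    have : -⟪θ, η⟫ ≤ ‖η‖ := by
      have := abs_real_inner_le_norm θ η
      rw [hθ, one_mul] at this
      exact (neg_le_abs _).trans this
    unfold ufun
    rw [div_le_iff₀ (by positivity)]
    calc -⟪θ, η⟫ ≤ ‖η‖ := this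
      _ = _ := by field_simp
  have hu2 : ufun θ η^(3-2*ε) ≤ ‖η‖^(-(2-2*ε)) * ufun θ η := by
    have : ufun θ η^(3-2*ε) = ufun θ η^(2-2*ε) * ufun θ η := by
      rw [← Real.rpow_add_one hup.ne']; congr 1; ring
    rw [this, Real.rpow_neg hηp.le, ← Real.inv_rpow hηp.le]
    gcongr
  have hη2 : ‖η‖^(γ+2*ε-2) ≤ (‖ζ‖/2)^(γ+2*ε-2) :=
    Real.rpow_le_rpow_of_nonpos (by linarith) (by linarith) heγ
  calc ‖η‖^γ * ufun θ η^(3-2*ε) * jap ξ^(-b)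
      ≤ ‖η‖^γ * (‖η‖^(-(2-2*ε)) * ufun θ η) * ‖w‖^(-b) := by
        have := jap_pos ξ
        gcongr
    _ = ‖η‖^(γ+2*ε-2) * ‖w‖^(-b) * ufun θ η := by
        have : ‖η‖^(γ+2*ε-2) = ‖η‖^γ * ‖η‖^(-(2-2*ε)) := by
          rw [← Real.rpow_add hηp]; congr 1; ring
        rw [this]; ring
    _ ≤ _ := by gcongr

lemma kernelB (m : ℕ) (hm : 1 ≤ m) (γ ε b : ℝ) (hγ : 0 ≤ γ) (hb : 0 ≤ b) (hbm : b < m)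
    (hs : γ + (m - b) ≤ 2 - 2 * ε) :
    ∃ K : ℝ≥0∞, K ≠ ⊤ ∧ ∀ θ : En (m+1), ‖θ‖ = 1 → ∀ lam : ℝ, 0 < lam → ∀ ζ : En (m+1),
      ∫⁻ ξ, kB γ ε b θ lam (ξ, ζ + ξ) ≤ K * ENNReal.ofReal lam := by
  set p := 2 * (m - b) with hp
  have hp0 : 0 ≤ p := by linarith
  have hkf := kern_finite m hm p b hp0 hbm (by linarith)
  set e := γ + 2 * ε - 2 with he
  have he1 : e + (m - b) ≤ 0 := by linarith
  set c1 : ℝ := (2:ℝ)^(-e) * 2^(p/2) * (9/10)^(e + (m-b)) with hc1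
  set K1 : ℝ≥0∞ := ENNReal.ofReal c1 * kern m p b 1 with hK1
  have hK1f : K1 ≠ ⊤ := ENNReal.mul_ne_top ENNReal.ofReal_ne_top hkf.ne
  refine ⟨K1 * ENNReal.ofReal 80, ENNReal.mul_ne_top hK1f ENNReal.ofReal_ne_top, ?_⟩
  intro θ hθ lam hlam ζ
  obtain ⟨I, hI, hsplit⟩ := exists_split m θ hθ
  have hmk := meas_kB γ ε b θ lam
  rw [hsplit _ (by fun_prop)]
  rw [lintegral_lintegral_swap (by
    apply Measurable.aemeasurable
    have : Measurable (fun q : ℝ × En m => q.1 • θ + I q.2) :=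
      (measurable_fst.smul_const θ).add (I.continuous.measurable.comp measurable_snd)
    exact hmk.comp (by fun_prop))]
  have hwae : ∀ᵐ w : En m, w ≠ 0 := by
    have : Nonempty (Fin m) := ⟨⟨0, hm⟩⟩
    have : Nontrivial (En m) := inferInstance
    exact compl_mem_ae_iff.2 (measure_singleton 0)
  have hBP := fun t w ξ η hξ hη hw h₀ P hh hP h =>
    B_point γ ε b lam hb (by linarith) (by linarith) θ ζ hθ I hI t w ξ η hξ hη hw h₀ P hh hP h
  by_cases hζ : 9/10 ≤ ‖ζ‖
  swap
  · refine le_trans (le_of_eq ?_) bot_le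
    have hz : ∀ᵐ w : En m, (∫⁻ t : ℝ, kB γ ε b θ lam (t • θ + I w, ζ + (t • θ + I w))) = 0 := by
      filter_upwards [hwae] with w hw
      have : ∀ t : ℝ, kB γ ε b θ lam (t • θ + I w, ζ + (t • θ + I w)) = 0 := by
        intro t
        apply indicator_of_notMem
        intro h
        exact hζ (hBP t w _ _ rfl rfl hw _ _ rfl rfl h).2.2.2.1
      simp [this]
    rw [lintegral_congr_ae hz]; simp
  have hζp : 0 < ‖ζ‖ := by linarith
  have inner : ∀ w : En m, w ≠ 0 →
      (∫⁻ t : ℝ, kB γ ε b θ lam (t • θ + I w, ζ + (t • θ + I w))) ≤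
      ENNReal.ofReal ((‖ζ‖/2)^e * (2 * ‖ζ‖^2)^(p/2)) *
        ENNReal.ofReal ((‖ζ‖^2+‖w‖^2)^(-p/2) * ‖w‖^(-b)) * ENNReal.ofReal (80 * lam) := by
    intro w hw
    set h₀ := -⟪θ, ζ⟫ with hh₀
    set P := ‖ζ - ⟪θ, ζ⟫ • θ + I w‖^2 with hP
    set F1 : ℝ → ℝ≥0∞ := {t : ℝ | (t • θ + I w, ζ + (t • θ + I w)) ∈ setB θ lam}.indicator
      (fun t => ENNReal.ofReal (ufun θ (ζ + (t • θ + I w)))) with hF1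
    have hF1i : ∫⁻ t, F1 t ≤ ENNReal.ofReal (80 * lam) := by
      apply oneB h₀ P (‖w‖^2) (‖ζ‖^2) lam (by positivity) (by positivity) (by positivity) hlam
      intro t ht
      have hmem := mem_of_indicator_ne_zero ht
      have := hBP t w _ _ rfl rfl hw _ _ hh₀ hP hmem
      refine ⟨this.2.1.1, this.2.1.2.1, this.2.1.2.2.1, this.2.1.2.2.2.1, this.2.1.2.2.2.2, ?_⟩
      rw [hF1, indicator_of_mem hmem, this.1]
    calc _ ≤ ∫⁻ t, ENNReal.ofReal ((‖ζ‖/2)^e * (2 * ‖ζ‖^2)^(p/2)) *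
        ENNReal.ofReal ((‖ζ‖^2+‖w‖^2)^(-p/2) * ‖w‖^(-b)) * F1 t := by
          apply lintegral_mono
          intro t
          by_cases hmem : (t • θ + I w, ζ + (t • θ + I w)) ∈ setB θ lam
          · have hmem' : t ∈ {t : ℝ | (t • θ + I w, ζ + (t • θ + I w)) ∈ setB θ lam} := hmem
            have := hBP t w _ _ rfl rfl hw _ _ hh₀ hP hmem
            obtain ⟨-, -, q1, q2, q3, q4⟩ := this
            simp only [kB]
            rw [hF1, indicator_of_mem hmem, indicator_of_mem hmem',
              ← ENNReal.ofReal_mul (by positivity), ← ENNReal.ofReal_mul (by positivity)]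
            apply ENNReal.ofReal_le_ofReal
            refine q4.trans ?_
            have hk : 1 ≤ (2 * ‖ζ‖^2)^(p/2) * (‖ζ‖^2+‖w‖^2)^(-p/2) := by
              have e1 : (‖ζ‖^2+‖w‖^2)^(-p/2) = ((‖ζ‖^2+‖w‖^2)^(p/2))⁻¹ := by
                rw [← Real.rpow_neg (by positivity)]; congr 1; ring
              rw [e1, ← div_eq_mul_inv, one_le_div (by positivity)]
              have : ‖w‖^2 ≤ ‖ζ‖^2 := by gcongr
              gcongr
              linarith
            calc (‖ζ‖/2)^(γ+2*ε-2) * ‖w‖^(-b) * ufun θ (ζ + (t • θ + I w))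
                = 1 * ((‖ζ‖/2)^e * ‖w‖^(-b) * ufun θ (ζ + (t • θ + I w))) := by rw [he]; ring
              _ ≤ ((2 * ‖ζ‖^2)^(p/2) * (‖ζ‖^2+‖w‖^2)^(-p/2)) *
                  ((‖ζ‖/2)^e * ‖w‖^(-b) * ufun θ (ζ + (t • θ + I w))) := by gcongr
              _ = _ := by ring
          · simp only [kB]
            rw [indicator_of_notMem hmem]; exact bot_le
      _ = ENNReal.ofReal ((‖ζ‖/2)^e * (2 * ‖ζ‖^2)^(p/2)) *
        ENNReal.ofReal ((‖ζ‖^2+‖w‖^2)^(-p/2) * ‖w‖^(-b)) * ∫⁻ t, F1 t := by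
          rw [lintegral_const_mul' _ _ (ENNReal.mul_ne_top ENNReal.ofReal_ne_top ENNReal.ofReal_ne_top)]
      _ ≤ _ := by gcongr
  calc _ ≤ ∫⁻ w : En m, ENNReal.ofReal ((‖ζ‖/2)^e * (2 * ‖ζ‖^2)^(p/2)) *
        ENNReal.ofReal ((‖ζ‖^2+‖w‖^2)^(-p/2) * ‖w‖^(-b)) * ENNReal.ofReal (80 * lam) := by
        apply lintegral_mono_ae
        filter_upwards [hwae] with w hw
        exact inner w hw
    _ = ENNReal.ofReal ((‖ζ‖/2)^e * (2 * ‖ζ‖^2)^(p/2)) * kern m p b ‖ζ‖ * ENNReal.ofReal (80 * lam) := by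
        rw [lintegral_mul_const' _ _ ENNReal.ofReal_ne_top, lintegral_const_mul' _ _ ENNReal.ofReal_ne_top]
        rfl
    _ = ENNReal.ofReal (((‖ζ‖/2)^e * (2 * ‖ζ‖^2)^(p/2)) * ‖ζ‖^((m:ℝ)-p-b)) * kern m p b 1 *
        ENNReal.ofReal (80 * lam) := by
        rw [kern_scale m p b _ hζp, ENNReal.ofReal_mul (p := (‖ζ‖/2)^e * (2 * ‖ζ‖^2)^(p/2)) (by positivity)]; ring
    _ ≤ ENNReal.ofReal c1 * kern m p b 1 * ENNReal.ofReal (80 * lam) := by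
        gcongr
        have e1 : ((‖ζ‖/2)^e * (2 * ‖ζ‖^2)^(p/2)) * ‖ζ‖^((m:ℝ)-p-b) =
            (2:ℝ)^(-e) * 2^(p/2) * ‖ζ‖^(e + (m-b)) := by
          rw [Real.div_rpow hζp.le (by norm_num), Real.mul_rpow (by norm_num) (by positivity),
            Real.rpow_neg (by norm_num), ← Real.rpow_natCast ‖ζ‖ 2, ← Real.rpow_mul hζp.le]
          have : ‖ζ‖^(e + (m-b)) = ‖ζ‖^e * ‖ζ‖^(((2:ℕ):ℝ) * (p/2)) * ‖ζ‖^((m:ℝ)-p-b) := by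
            rw [← Real.rpow_add hζp, ← Real.rpow_add hζp]; congr 1; push_cast; ring
          rw [this]; field_simp
        rw [e1, hc1]
        have : ‖ζ‖^(e + (m-b)) ≤ (9/10)^(e + (m-b)) :=
          Real.rpow_le_rpow_of_nonpos (by norm_num) hζ he1
        gcongr
    _ = _ := by rw [ENNReal.ofReal_mul (p := 80) (by norm_num), hK1]; ring

lemma hausdorff_En (m : ℕ) : ∃ C : ℝ≥0∞, C ≠ ⊤ ∧ ∀ A : Set (En m), μH[(m:ℝ)] A ≤ C * volume A := by
  obtain ⟨K, hK⟩ : ∃ K, LipschitzWith K (WithLp.toLp 2 : (Fin m → ℝ) → En m) :=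
    ⟨_, PiLp.lipschitzWith_toLp 2 (fun _ : Fin m => ℝ)⟩
  refine ⟨(K : ℝ≥0∞) ^ (m:ℝ), ENNReal.rpow_ne_top_of_nonneg (by positivity) ENNReal.coe_ne_top, ?_⟩
  intro A
  have h1 : A = (WithLp.toLp 2 : (Fin m → ℝ) → En m) '' ((WithLp.toLp 2 : (Fin m → ℝ) → En m) ⁻¹' A) := by
    rw [image_preimage_eq]
    exact (WithLp.toLp_surjective 2)
  have h2 := hK.hausdorffMeasure_image_le (d := (m:ℝ)) (by positivity)
    ((WithLp.toLp 2 : (Fin m → ℝ) → En m) ⁻¹' A)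
  rw [← h1] at h2
  refine h2.trans ?_
  gcongr
  have h3 : (μH[(m:ℝ)] : Measure (Fin m → ℝ)) = volume := by
    have := hausdorffMeasure_pi_real (ι := Fin m)
    rwa [Fintype.card_fin] at this
  rw [h3]
  exact le_of_eq ((PiLp.volume_preserving_toLp (Fin m)).measure_preimage_emb
    (MeasurableEquiv.toLp 2 (Fin m → ℝ)).measurableEmbedding A)

lemma normalize_lip {n : ℕ} (x y : En n) (hx : 1 ≤ ‖x‖) (hy : 1 ≤ ‖y‖) :
    ‖‖x‖⁻¹ • x - ‖y‖⁻¹ • y‖ ≤ 2 * ‖x - y‖ := by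
  have e : ‖x‖⁻¹ • x - ‖y‖⁻¹ • y = ‖x‖⁻¹ • (x - y) + (‖x‖⁻¹ - ‖y‖⁻¹) • y := by
    module
  rw [e]
  have hx0 : 0 < ‖x‖ := by linarith
  have hy0 : 0 < ‖y‖ := by linarith
  have hi : ‖x‖⁻¹ ≤ 1 := inv_le_one_of_one_le₀ hx
  have h1 : ‖‖x‖⁻¹ • (x - y)‖ ≤ ‖x - y‖ := by
    rw [norm_smul, norm_inv, norm_norm]
    exact mul_le_of_le_one_left (norm_nonneg _) hi
  have h2 : ‖(‖x‖⁻¹ - ‖y‖⁻¹) • y‖ ≤ ‖x - y‖ := by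
    rw [norm_smul, Real.norm_eq_abs]
    have e2 : |‖x‖⁻¹ - ‖y‖⁻¹| * ‖y‖ = ‖x‖⁻¹ * |‖y‖ - ‖x‖| := by
      rw [← abs_of_pos hy0, ← abs_mul, abs_of_pos hy0]
      have : (‖x‖⁻¹ - ‖y‖⁻¹) * ‖y‖ = ‖x‖⁻¹ * (‖y‖ - ‖x‖) := by field_simp
      rw [this, abs_mul, abs_of_pos (inv_pos.2 hx0)]
    rw [e2]
    calc _ ≤ 1 * |‖y‖ - ‖x‖| := by gcongr
      _ ≤ 1 * ‖y - x‖ := by gcongr; exact abs_norm_sub_norm_le y x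
      _ = ‖x - y‖ := by rw [one_mul, norm_sub_rev]
  linarith [norm_add_le (‖x‖⁻¹ • (x - y)) ((‖x‖⁻¹ - ‖y‖⁻¹) • y)]

lemma split_surj {m : ℕ} (θ : En (m+1)) (hθ : ‖θ‖ = 1) (I : En m →ₗᵢ[ℝ] En (m+1))
    (hI : ∀ w, ⟪θ, I w⟫ = 0) (v : En (m+1)) (hv : ⟪θ, v⟫ = 0) : ∃ w, I w = v := by
  have hle : LinearMap.range I.toLinearMap ≤ (ℝ ∙ θ)ᗮ := by
    rintro _ ⟨w, rfl⟩
    rw [Submodule.mem_orthogonal_singleton_iff_inner_right]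
    exact hI w
  have hθ0 : θ ≠ 0 := by rintro rfl; simp at hθ
  have hf : Module.finrank ℝ (LinearMap.range I.toLinearMap) = Module.finrank ℝ ((ℝ ∙ θ)ᗮ : Submodule ℝ (En (m+1))) := by
    rw [LinearMap.finrank_range_of_inj I.injective]
    have := Submodule.finrank_add_finrank_orthogonal (ℝ ∙ θ)
    rw [finrank_span_singleton hθ0, finrank_euclideanSpace_fin] at this
    rw [finrank_euclideanSpace_fin]; omega
  have := Submodule.eq_of_le_of_finrank_eq hle hf
  have hv' : v ∈ (ℝ ∙ θ)ᗮ := by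
    rw [Submodule.mem_orthogonal_singleton_iff_inner_right]; exact hv
  rw [← this] at hv'
  exact hv'

open scoped Pointwise in
lemma cap_bound (m : ℕ) (R : ℝ) (hR : 0 < R) : ∃ C : ℝ≥0∞, C ≠ ⊤ ∧ ∀ e : En (m+1), ‖e‖ = 1 →
    ∀ s : Set (sphere (0 : En (m+1)) 1), MeasurableSet s → (∀ ω ∈ s, 1 / R ≤ ⟪e, (ω : En (m+1))⟫) →
      μH[(m:ℝ)] ((↑) '' s : Set (En (m+1))) ≤ C * (volume : Measure (En (m+1))).toSphere s := by
  obtain ⟨C0, hC0, hC0b⟩ := hausdorff_En m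
  set c : ℝ := 1 / (1 + R) with hc
  have hcp : 0 < c := by positivity
  set d : ℝ≥0∞ := ENNReal.ofReal (c/2) * ENNReal.ofReal ((c/2)^m) with hd
  have hdp : d ≠ 0 := by
    rw [hd, ← ENNReal.ofReal_mul (by positivity)]; simp; positivity
  have hdt : d ≠ ⊤ := ENNReal.mul_ne_top ENNReal.ofReal_ne_top ENNReal.ofReal_ne_top
  refine ⟨2 ^ (m:ℝ) * C0 * d⁻¹, ENNReal.mul_ne_top (ENNReal.mul_ne_top
    (ENNReal.rpow_ne_top_of_nonneg (by positivity) (by simp)) hC0) (ENNReal.inv_ne_top.2 hdp), ?_⟩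
  intro e he s hs hcap
  obtain ⟨I, hI, hsplit⟩ := exists_split m e he
  have hnorm1 : ∀ w, ‖e + I w‖ ^ 2 = 1 + ‖w‖^2 := by
    intro w
    have := (split_norm e he I hI 1 w).1
    simpa using this
  have hnorm2 : ∀ w, 1 ≤ ‖e + I w‖ := by
    intro w
    apply le_of_sq_le_sq _ (norm_nonneg _)
    rw [hnorm1]; nlinarith [sq_nonneg ‖w‖]
  set g : En m → En (m+1) := fun w => ‖e + I w‖⁻¹ • (e + I w) with hg
  have hgl : LipschitzWith 2 g := by
    apply LipschitzWith.of_dist_le_mul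
    intro x y
    rw [dist_eq_norm, dist_eq_norm]
    refine (normalize_lip _ _ (hnorm2 x) (hnorm2 y)).trans ?_
    have : e + I x - (e + I y) = I (x - y) := by rw [map_sub]; abel
    rw [this, I.norm_map]; simp
  set A : Set (En m) := {w | ‖w‖ ≤ R ∧ g w ∈ ((↑) '' s : Set (En (m+1)))} with hA
  have himg : ((↑) '' s : Set (En (m+1))) ⊆ g '' A := by
    rintro _ ⟨ω, hω, rfl⟩
    have h1 := hcap ω hω
    set a := ⟪e, (ω : En (m+1))⟫ with ha
    have ha0 : 0 < a := lt_of_lt_of_le (by positivity) h1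
    obtain ⟨w, hw⟩ := split_surj e he I hI (a⁻¹ • (ω : En (m+1)) - e) (by
      rw [inner_sub_right, inner_smul_right, real_inner_self_eq_norm_sq, he, ← ha]
      field_simp; simp)
    have hω1 : ‖(ω : En (m+1))‖ = 1 := by simpa using ω.2
    have h2 : e + I w = a⁻¹ • (ω : En (m+1)) := by rw [hw]; abel
    have h3 : ‖e + I w‖ = a⁻¹ := by
      rw [h2, norm_smul, hω1, mul_one, Real.norm_eq_abs, abs_of_pos (inv_pos.2 ha0)]
    have hgw : g w = ω := by
      simp only [hg]
      rw [h3, h2, smul_smul, inv_inv, mul_inv_cancel₀ ha0.ne', one_smul]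
    refine ⟨w, ⟨?_, ?_⟩, hgw⟩
    · have h4 := hnorm1 w
      rw [h3] at h4
      have h5 : a⁻¹ ≤ R := by
        rw [inv_le_comm₀ ha0 hR, ← one_div]; exact h1
      have : 0 < a⁻¹ := inv_pos.2 ha0
      apply le_of_sq_le_sq _ hR.le
      nlinarith
    · rw [hgw]; exact ⟨ω, hω, rfl⟩
  have hvol : d * volume A ≤ (volume : Measure (En (m+1))).toSphere s := by
    rw [Measure.toSphere_apply' _ hs]
    set T : Set (En (m+1)) := Ioo (0:ℝ) 1 • ((↑) '' s : Set (En (m+1))) with hT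
    have hTge : d * volume A ≤ volume T := by
      rw [← measure_toMeasurable T]
      set T' := toMeasurable volume T
      have hTm : MeasurableSet T' := measurableSet_toMeasurable _ _
      rw [← lintegral_indicator_one hTm, hsplit _ (measurable_one.indicator hTm)]
      calc d * volume A = ∫⁻ t in Ioo (c/2) c, ENNReal.ofReal ((c/2)^m) * volume A := by
            rw [lintegral_const, Measure.restrict_apply MeasurableSet.univ, univ_inter, Real.volume_Ioo, hd]
            have : c - c/2 = c/2 := by ring
            rw [this]; ring
        _ ≤ ∫⁻ t in Ioo (c/2) c, ∫⁻ w : En m, T'.indicator 1 (t • e + I w) := by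
            apply setLIntegral_mono' measurableSet_Ioo
            intro t ht
            have ht0 : 0 < t := lt_trans (by positivity) ht.1
            calc ENNReal.ofReal ((c/2)^m) * volume A ≤ ENNReal.ofReal (t^m) * volume A := by
                  gcongr
                  exact ht.1.le
              _ = volume (t • A) := by
                  rw [Measure.addHaar_smul, finrank_euclideanSpace_fin, abs_of_pos (by positivity)]
              _ ≤ volume ((fun w : En m => t • e + I w) ⁻¹' T') := by
                  apply measure_mono
                  rintro _ ⟨w, hw, rfl⟩
                  apply subset_toMeasurable
                  obtain ⟨hwR, ω, hω, hgw⟩ := hw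
                  refine ⟨t * ‖e + I w‖, ⟨?_, ?_⟩, ω, ⟨ω, hω, rfl⟩, ?_⟩
                  · have := hnorm2 w
                    positivity
                  · have h1 : ‖e + I w‖ ≤ 1 + R := by
                      refine (norm_add_le _ _).trans ?_
                      rw [he, I.norm_map]; linarith
                    calc t * ‖e + I w‖ ≤ t * (1 + R) := by gcongr
                      _ < c * (1 + R) := by gcongr; exact ht.2
                      _ = 1 := by rw [hc]; field_simp
                  · simp only [hgw, hg]
                    rw [smul_smul, mul_assoc, mul_inv_cancel₀ (by have := hnorm2 w; positivity), mul_one]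
                    simp
              _ = ∫⁻ w : En m, T'.indicator 1 (t • e + I w) := by
                  rw [← lintegral_indicator_one]
                  · rfl
                  · exact hTm.preimage (by have := I.continuous; fun_prop)
        _ ≤ _ := setLIntegral_le_lintegral _ _
    refine hTge.trans ?_
    rw [finrank_euclideanSpace_fin]
    exact le_mul_of_one_le_left' (by exact_mod_cast Nat.succ_pos m)
  calc μH[(m:ℝ)] ((↑) '' s : Set (En (m+1))) ≤ μH[(m:ℝ)] (g '' A) := measure_mono himg
    _ ≤ 2 ^ (m:ℝ) * μH[(m:ℝ)] A := by
        simpa using hgl.hausdorffMeasure_image_le (d := (m:ℝ)) (by positivity) A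
    _ ≤ 2 ^ (m:ℝ) * (C0 * volume A) := by gcongr; exact hC0b A
    _ = 2 ^ (m:ℝ) * C0 * d⁻¹ * (d * volume A) := by
        have : d⁻¹ * d = 1 := ENNReal.inv_mul_cancel hdp hdt
        calc _ = 2 ^ (m:ℝ) * C0 * (d⁻¹ * d) * volume A := by rw [this]; ring
          _ = _ := by ring
    _ ≤ _ := by gcongr

lemma sphere_bound (m : ℕ) : ∃ C : ℝ≥0∞, C ≠ ⊤ ∧ 
    ∀ s : Set (sphere (0 : En (m+1)) 1), MeasurableSet s →
      μH[(m:ℝ)] ((↑) '' s : Set (En (m+1))) ≤ C * (volume : Measure (En (m+1))).toSphere s := by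
  obtain ⟨C, hC, h⟩ := cap_bound m (m+1) (by positivity)
  refine ⟨∑ i : Fin (m+1) × Bool, C, by simp [ENNReal.mul_eq_top, hC], ?_⟩
  intro s hs
  set E : Fin (m+1) × Bool → En (m+1) := fun i =>
    (if i.2 then (1:ℝ) else -1) • EuclideanSpace.single i.1 (1:ℝ) with hE
  have hEn : ∀ i, ‖E i‖ = 1 := by
    intro i
    simp only [hE, norm_smul, PiLp.norm_single]
    split_ifs <;> simp
  set cap : Fin (m+1) × Bool → Set (sphere (0 : En (m+1)) 1) := fun i =>
    {ω | ω ∈ s ∧ 1 / ((m:ℝ)+1) ≤ ⟪E i, (ω : En (m+1))⟫} with hcap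
  have hcm : ∀ i, MeasurableSet (cap i) := by
    intro i
    have h2 : MeasurableSet {ω : sphere (0 : En (m+1)) 1 | 1 / ((m:ℝ)+1) ≤ ⟪E i, (ω : En (m+1))⟫} :=
      measurableSet_le measurable_const (by fun_prop)
    exact hs.inter h2
  have hcov : ((↑) '' s : Set (En (m+1))) ⊆ ⋃ i, ((↑) '' (cap i) : Set (En (m+1))) := by
    rintro _ ⟨ω, hω, rfl⟩
    have hω1 : ‖(ω : En (m+1))‖ = 1 := by simpa using ω.2
    have hω2 : ∑ i, (ω : En (m+1)) i ^ 2 = 1 := by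
      rw [← EuclideanSpace.real_norm_sq_eq, hω1]; norm_num
    obtain ⟨i, -, hi⟩ : ∃ i ∈ (Finset.univ : Finset (Fin (m+1))), 1 / ((m:ℝ)+1) ≤ (ω : En (m+1)) i ^ 2 := by
      apply Finset.exists_le_of_sum_le Finset.univ_nonempty
      rw [hω2]; simp
      rw [mul_inv_cancel₀ (by positivity)]
    have h1 : 1 / ((m:ℝ)+1) ≤ |(ω : En (m+1)) i| := by
      have h2 : 1 / ((m:ℝ)+1) ≤ 1 := by
        rw [div_le_one (by positivity)]; linarith [(Nat.cast_nonneg m : (0:ℝ) ≤ m)]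
      have h3 : 0 < 1 / ((m:ℝ)+1) := by positivity
      apply le_of_sq_le_sq _ (abs_nonneg _)
      rw [sq_abs]; nlinarith
    rw [mem_iUnion]
    rcases abs_cases ((ω : En (m+1)) i) with ⟨ha, -⟩ | ⟨ha, -⟩
    · refine ⟨(i, true), ω, ⟨hω, ?_⟩, rfl⟩
      rw [ha] at h1
      simpa [hE, EuclideanSpace.inner_single_left] using h1
    · refine ⟨(i, false), ω, ⟨hω, ?_⟩, rfl⟩
      rw [ha] at h1
      simpa [hE, EuclideanSpace.inner_single_left] using h1
  calc _ ≤ μH[(m:ℝ)] (⋃ i, ((↑) '' (cap i) : Set (En (m+1)))) := measure_mono hcov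
    _ ≤ ∑ i, μH[(m:ℝ)] ((↑) '' (cap i) : Set (En (m+1))) := measure_iUnion_fintype_le _ _
    _ ≤ ∑ i : Fin (m+1) × Bool, C * (volume : Measure (En (m+1))).toSphere s := by
        apply Finset.sum_le_sum
        intro i _
        refine (h (E i) (hEn i) (cap i) (hcm i) (fun ω hω => by simpa using hω.2)).trans ?_
        gcongr
        exact fun ω hω => hω.1
    _ = _ := by rw [Finset.sum_mul]

lemma sphere_lint (m : ℕ) : ∃ C : ℝ≥0∞, C ≠ ⊤ ∧ ∀ (c : En (m+1)) (ρ : ℝ), 0 < ρ →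
    ∀ f : En (m+1) → ℝ≥0∞, Measurable f →
      ∫⁻ x in sphere c ρ, f x ∂μH[(m:ℝ)] ≤ C * ENNReal.ofReal (ρ^m) *
        ∫⁻ ω : sphere (0 : En (m+1)) 1, f (c + ρ • (ω : En (m+1)))
          ∂(volume : Measure (En (m+1))).toSphere := by
  obtain ⟨C, hC, h⟩ := sphere_bound m
  refine ⟨C, hC, ?_⟩
  intro c ρ hρ f hf
  set Φ : En (m+1) → En (m+1) := fun x => c + ρ • x with hΦ
  have hΦl : LipschitzWith (Real.toNNReal ρ) Φ := by
    apply LipschitzWith.of_dist_le_mul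
    intro x y
    simp only [hΦ, dist_add_left, dist_smul₀]
    rw [Real.norm_eq_abs, abs_of_pos hρ, Real.coe_toNNReal _ hρ.le]
  have hΦm : Measurable (fun ω : sphere (0 : En (m+1)) 1 => Φ ω) := by fun_prop
  have hle : (μH[(m:ℝ)] : Measure (En (m+1))).restrict (sphere c ρ) ≤
      (C * ENNReal.ofReal (ρ^m)) • ((volume : Measure (En (m+1))).toSphere.map (fun ω : sphere (0 : En (m+1)) 1 => Φ ω)) := by
    rw [Measure.le_iff]
    intro B hB
    rw [Measure.restrict_apply hB, Measure.smul_apply, Measure.map_apply hΦm hB]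
    set s : Set (sphere (0 : En (m+1)) 1) := (fun ω => Φ ω) ⁻¹' B with hs
    have hsm : MeasurableSet s := hΦm hB
    have hsub : B ∩ sphere c ρ ⊆ Φ '' ((↑) '' s : Set (En (m+1))) := by
      rintro x ⟨hxB, hxs⟩
      have hxn : ‖x - c‖ = ρ := by rwa [mem_sphere, dist_eq_norm] at hxs
      have hω : ρ⁻¹ • (x - c) ∈ sphere (0 : En (m+1)) 1 := by
        rw [mem_sphere_zero_iff_norm, norm_smul, hxn, Real.norm_eq_abs, abs_of_pos (inv_pos.2 hρ),
          inv_mul_cancel₀ hρ.ne']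
      have hΦx : Φ (ρ⁻¹ • (x - c)) = x := by
        simp only [hΦ]; rw [smul_smul, mul_inv_cancel₀ hρ.ne', one_smul]; abel
      refine ⟨ρ⁻¹ • (x - c), ⟨⟨_, hω⟩, ?_, rfl⟩, hΦx⟩
      simp only [hs, mem_preimage]; rw [hΦx]; exact hxB
    calc μH[(m:ℝ)] (B ∩ sphere c ρ) ≤ μH[(m:ℝ)] (Φ '' ((↑) '' s : Set (En (m+1)))) := measure_mono hsub
      _ ≤ (Real.toNNReal ρ : ℝ≥0∞) ^ (m:ℝ) * μH[(m:ℝ)] ((↑) '' s : Set (En (m+1))) :=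
          hΦl.hausdorffMeasure_image_le (by positivity) _
      _ ≤ ENNReal.ofReal (ρ^m) * (C * (volume : Measure (En (m+1))).toSphere s) := by
          gcongr
          · rw [ENNReal.rpow_natCast, ENNReal.ofReal_pow hρ.le]; exact le_rfl
          · exact h s hsm
      _ = _ := by rw [smul_eq_mul]; ring
  calc _ ≤ ∫⁻ x, f x ∂((C * ENNReal.ofReal (ρ^m)) • ((volume : Measure (En (m+1))).toSphere.map (fun ω : sphere (0 : En (m+1)) 1 => Φ ω))) :=
        lintegral_mono' hle le_rfl
    _ = _ := by
        rw [lintegral_smul_measure, lintegral_map hf hΦm]; rfl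

theorem polar_lint (m : ℕ) (f : En (m+1) → ℝ≥0∞) (hf : Measurable f) :
    ∫⁻ x, f x = ∫⁻ ω : sphere (0 : En (m+1)) 1, ∫⁻ r in Ioi (0:ℝ),
      ENNReal.ofReal (r^m) * f (r • (ω : En (m+1)))
      ∂volume ∂(volume : Measure (En (m+1))).toSphere := by
  have h1 : ∫⁻ x, f x = ∫⁻ x : ({(0 : En (m+1))}ᶜ : Set (En (m+1))), f x
      ∂(Measure.comap Subtype.val (volume : Measure (En (m+1)))) := by
    rw [lintegral_subtype_comap (measurableSet_singleton _).compl f,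
      restrict_compl_singleton]
  rw [h1]
  have h2 := (volume : Measure (En (m+1))).measurePreserving_homeomorphUnitSphereProd
  have h3 := h2.lintegral_comp_emb (Homeomorph.measurableEmbedding _)
    (fun p : sphere (0 : En (m+1)) 1 × Ioi (0:ℝ) => f ((p.2 : ℝ) • (p.1 : En (m+1))))
  have h4 : ∀ x : ({(0 : En (m+1))}ᶜ : Set (En (m+1))),
      f (((homeomorphUnitSphereProd (En (m+1)) x).2 : ℝ) •
        ((homeomorphUnitSphereProd (En (m+1)) x).1 : En (m+1))) = f x := by
    intro x
    have hx : (x : En (m+1)) ≠ 0 := x.2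
    simp only [homeomorphUnitSphereProd_apply_snd_coe, homeomorphUnitSphereProd_apply_fst_coe]
    rw [smul_smul, mul_inv_cancel₀ (norm_ne_zero_iff.2 hx), one_smul]
  simp only [h4] at h3
  rw [h3]
  have hm : Measurable (fun p : sphere (0 : En (m+1)) 1 × Ioi (0:ℝ) =>
      f ((p.2 : ℝ) • (p.1 : En (m+1)))) := by
    apply hf.comp; fun_prop
  rw [lintegral_prod _ hm.aemeasurable]
  apply lintegral_congr
  intro ω
  have hd : Module.finrank ℝ (En (m+1)) - 1 = m := by simp
  rw [hd, Measure.volumeIoiPow, lintegral_withDensity_eq_lintegral_mul _ (by fun_prop)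
    (g := fun y : Ioi (0:ℝ) => f ((y : ℝ) • (ω : En (m+1)))) (by apply hf.comp; fun_prop), ← lintegral_subtype_comap measurableSet_Ioi]
  rfl

theorem shell_lint (m : ℕ) : ∃ C : ℝ≥0∞, C ≠ ⊤ ∧ ∀ (c : En (m+1)) (k lam : ℝ), 0 < k →
    ∀ g : En (m+1) → ℝ≥0∞, Measurable g →
    ∫⁻ r in {r : ℝ | 0 < r ∧ |1 - r| ≤ lam}, ∫⁻ ξ in sphere c (r*k), g ξ ∂μH[(m:ℝ)] ≤
      C * ENNReal.ofReal k⁻¹ * ∫⁻ ξ in {ξ | |‖ξ - c‖ - k| ≤ lam * k}, g ξ := by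
  obtain ⟨C, hC, H⟩ := sphere_lint m
  refine ⟨C, hC, ?_⟩
  intro c k lam hk g hg
  have hI : MeasurableSet {r : ℝ | 0 < r ∧ |1 - r| ≤ lam} :=
    (measurableSet_lt (f := fun _ : ℝ => (0:ℝ)) (g := fun r : ℝ => r) (by fun_prop)
      (by fun_prop)).inter
      (measurableSet_le (f := fun r : ℝ => |1 - r|) (g := fun _ : ℝ => lam) (by fun_prop)
        (by fun_prop))
  have hS : MeasurableSet {ξ : En (m+1) | |‖ξ - c‖ - k| ≤ lam * k} :=
    measurableSet_le (f := fun ξ : En (m+1) => |‖ξ - c‖ - k|) (g := fun _ => lam * k)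
      (by fun_prop) (by fun_prop)
  have hT : MeasurableSet {s : ℝ | 0 < s ∧ |s - k| ≤ lam * k} :=
    (measurableSet_lt (f := fun _ : ℝ => (0:ℝ)) (g := fun r : ℝ => r) (by fun_prop)
      (by fun_prop)).inter
      (measurableSet_le (f := fun r : ℝ => |r - k|) (g := fun _ : ℝ => lam * k) (by fun_prop)
        (by fun_prop))
  set F : En (m+1) → ℝ≥0∞ := ({x : En (m+1) | |‖x‖ - k| ≤ lam * k}).indicator
    (fun x => g (c + x)) with hF
  have hFm : Measurable F := by
    apply Measurable.indicator
    · exact hg.comp (by fun_prop)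
    · exact measurableSet_le (f := fun ξ : En (m+1) => |‖ξ‖ - k|) (g := fun _ => lam * k)
        (by fun_prop) (by fun_prop)
  have e1 : ∫⁻ ξ in {ξ | |‖ξ - c‖ - k| ≤ lam * k}, g ξ = ∫⁻ x, F x := by
    rw [← lintegral_indicator hS, ← lintegral_add_left_eq_self _ c]
    apply lintegral_congr
    intro x
    simp only [hF, indicator, mem_ofPred_eq, add_sub_cancel_left]
  rw [e1, polar_lint m F hFm]
  calc ∫⁻ r in {r : ℝ | 0 < r ∧ |1 - r| ≤ lam}, ∫⁻ ξ in sphere c (r*k), g ξ ∂μH[(m:ℝ)]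
      ≤ ∫⁻ r in {r : ℝ | 0 < r ∧ |1 - r| ≤ lam}, C * ∫⁻ ω : sphere (0:En (m+1)) 1,
          ENNReal.ofReal ((r*k)^m) * F ((r*k) • (ω:En (m+1)))
          ∂(volume : Measure (En (m+1))).toSphere := by
        apply setLIntegral_mono' hI
        rintro r ⟨hr, hr1⟩
        refine (H c (r*k) (by positivity) g hg).trans ?_
        rw [mul_assoc, lintegral_const_mul]
        · gcongr with ω
          have hmem : ((r*k) • (ω : En (m+1))) ∈ {x : En (m+1) | |‖x‖ - k| ≤ lam * k} := by
            have hω : ‖(ω : En (m+1))‖ = 1 := by simp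
            simp only [mem_ofPred_eq, norm_smul, hω, mul_one, Real.norm_eq_abs]
            rw [abs_of_pos (mul_pos hr hk), show r*k - k = -((1-r)*k) by ring, abs_neg, abs_mul,
              abs_of_pos hk]
            gcongr
          rw [hF, indicator_of_mem hmem]
        · apply hFm.comp; fun_prop
    _ = C * ∫⁻ ω : sphere (0:En (m+1)) 1, ∫⁻ r in {r : ℝ | 0 < r ∧ |1 - r| ≤ lam},
          ENNReal.ofReal ((r*k)^m) * F ((r*k) • (ω:En (m+1))) ∂volume
          ∂(volume : Measure (En (m+1))).toSphere := by
        rw [lintegral_const_mul' _ _ hC, lintegral_lintegral_swap]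
        apply Measurable.aemeasurable
        apply Measurable.mul
        · fun_prop
        · apply hFm.comp; fun_prop
    _ ≤ C * ∫⁻ ω : sphere (0:En (m+1)) 1, ENNReal.ofReal k⁻¹ * ∫⁻ r in Ioi (0:ℝ),
          ENNReal.ofReal (r^m) * F (r • (ω : En (m+1)))
          ∂volume ∂(volume : Measure (En (m+1))).toSphere := by
        gcongr with ω
        set G : ℝ → ℝ≥0∞ := (Ioi (0:ℝ)).indicator
          (fun r => ENNReal.ofReal (r^m) * F (r • (ω : En (m+1)))) with hG
        have hGm : Measurable G := by
          apply Measurable.indicator _ measurableSet_Ioi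
          apply Measurable.mul
          · fun_prop
          · apply hFm.comp; fun_prop
        rw [← lintegral_indicator measurableSet_Ioi, ← hG, ← lintegral_indicator hI]
        have hsc : ENNReal.ofReal k⁻¹ * ∫⁻ r, G r = ∫⁻ r, G (r*k) := by
          have := Real.smul_map_volume_mul_right hk.ne'
          have h2 : ∫⁻ r, G (r*k) = ∫⁻ r, G r ∂(Measure.map (fun x => x * k) volume) := by
            rw [lintegral_map hGm (by fun_prop)]
          rw [h2, Real.map_volume_mul_right hk.ne', lintegral_smul_measure, abs_of_pos (by positivity)]
          rfl
        rw [hsc]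
        apply lintegral_mono
        intro r
        by_cases hr : r ∈ {r : ℝ | 0 < r ∧ |1 - r| ≤ lam}
        · have hmem : r * k ∈ Ioi (0:ℝ) := mul_pos hr.1 hk
          rw [indicator_of_mem hr]
          simp only [hG]
          rw [indicator_of_mem hmem]
        · rw [indicator_of_notMem hr]; exact bot_le
    _ = _ := by
        rw [lintegral_const_mul' _ _ ENNReal.ofReal_ne_top, mul_assoc]

theorem ray_bound (m : ℕ) (h : En (m+1) → ℂ) (hh : ContDiff ℝ 1 h)
    (h0 : Tendsto h (cocompact (En (m+1))) (nhds 0)) (c ω : En (m+1)) (hω : ‖ω‖ = 1)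
    (s : ℝ) :
    ENNReal.ofReal (‖h (c + s • ω)‖^2) ≤ ∫⁻ r in Ioi s,
      ENNReal.ofReal (‖h (c + r • ω)‖^2 + ‖fderiv ℝ h (c + r • ω)‖^2) := by
  have hcont : Continuous (fderiv ℝ h) := hh.continuous_fderiv (by norm_num)
  have hc : Continuous h := hh.continuous
  set B : ℝ → ℝ := fun r => ‖h (c + r • ω)‖^2 + ‖fderiv ℝ h (c + r • ω)‖^2 with hB
  have hBc : Continuous B := by fun_prop
  have hB0 : ∀ r, 0 ≤ B r := fun r => by positivity
  by_cases htop : ∫⁻ r in Ioi s, ENNReal.ofReal (B r) = ⊤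
  · rw [htop]; exact le_top
  have hint : IntegrableOn B (Ioi s) := by
    refine ⟨hBc.aestronglyMeasurable, ?_⟩
    rw [hasFiniteIntegral_iff_ofReal (Eventually.of_forall hB0)]
    exact lt_top_iff_ne_top.2 htop
  set φ' : ℝ → ℝ := fun r => 2 * ⟪h (c + r • ω), fderiv ℝ h (c + r • ω) ω⟫ with hφ'
  have hφc : Continuous φ' := by
    have : Continuous (fun r : ℝ => fderiv ℝ h (c + r • ω) ω) := by fun_prop
    fun_prop
  have hbd : ∀ r, |φ' r| ≤ B r := by
    intro r
    have h1 : |⟪h (c + r • ω), fderiv ℝ h (c + r • ω) ω⟫| ≤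
        ‖h (c + r • ω)‖ * ‖fderiv ℝ h (c + r • ω)‖ := by
      refine (abs_real_inner_le_norm _ _).trans ?_
      gcongr
      have := (fderiv ℝ h (c + r • ω)).le_opNorm ω
      rwa [hω, mul_one] at this
    simp only [hφ', hB, abs_mul, abs_two]
    nlinarith [sq_nonneg (‖h (c + r • ω)‖ - ‖fderiv ℝ h (c + r • ω)‖)]
  have hφint : IntegrableOn φ' (Ioi s) := by
    refine Integrable.mono' hint hφc.aestronglyMeasurable (Eventually.of_forall ?_)
    intro r; rw [Real.norm_eq_abs]; exact hbd r
  have hder : ∀ r ∈ Ici s, HasDerivAt (fun r : ℝ => ‖h (c + r • ω)‖^2) (φ' r) r := by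
    intro r _
    have h1 : HasDerivAt (fun r : ℝ => c + r • ω) ω r := by
      simpa using ((hasDerivAt_id r).smul_const ω).const_add c
    have h2 : HasDerivAt (fun r : ℝ => h (c + r • ω)) (fderiv ℝ h (c + r • ω) ω) r :=
      ((hh.differentiable (by norm_num)) (c + r • ω)).hasFDerivAt.comp_hasDerivAt r h1
    exact h2.norm_sq
  have hlim : Tendsto (fun r : ℝ => ‖h (c + r • ω)‖^2) atTop (nhds 0) := by
    have h1 : Tendsto (fun r : ℝ => c + r • ω) atTop (cocompact (En (m+1))) := by
      rw [← Metric.cobounded_eq_cocompact, ← tendsto_norm_atTop_iff_cobounded]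
      apply tendsto_atTop_mono (f := fun r : ℝ => r - ‖c‖)
      · intro r
        have := norm_sub_norm_le (r • ω) (-c)
        rw [norm_smul, hω, norm_neg, Real.norm_eq_abs, sub_neg_eq_add, add_comm (r • ω)] at this
        linarith [le_abs_self r]
      · exact tendsto_atTop_add_const_right _ _ tendsto_id
    have h2 := (h0.comp h1).norm.pow 2
    simpa using h2
  have hI := integral_Ioi_of_hasDerivAt_of_tendsto' hder hφint hlim
  rw [← ofReal_integral_eq_lintegral_ofReal hint (Eventually.of_forall hB0)]
  apply ENNReal.ofReal_le_ofReal
  have : ‖h (c + s • ω)‖^2 = ∫ r in Ioi s, - φ' r := by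
    rw [integral_neg, hI]; ring
  rw [this]
  apply setIntegral_mono hφint.neg hint
  intro r
  exact (neg_le_abs _).trans (hbd r)

theorem trace_shell (m : ℕ) (h : En (m+1) → ℂ) (hh : ContDiff ℝ 1 h)
    (h0 : Tendsto h (cocompact (En (m+1))) (nhds 0)) (c : En (m+1)) (k lam : ℝ) :
    ∫⁻ ξ in {ξ | |‖ξ - c‖ - k| ≤ lam * k}, ENNReal.ofReal (‖h ξ‖^2) ≤
      ENNReal.ofReal (2*lam*k) * ∫⁻ x, ENNReal.ofReal (‖h x‖^2 + ‖fderiv ℝ h x‖^2) := by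
  have hcont : Continuous (fderiv ℝ h) := hh.continuous_fderiv (by norm_num)
  have hc : Continuous h := hh.continuous
  have hS : MeasurableSet {ξ : En (m+1) | |‖ξ - c‖ - k| ≤ lam * k} :=
    measurableSet_le (f := fun ξ : En (m+1) => |‖ξ - c‖ - k|) (g := fun _ => lam * k)
      (by fun_prop) (by fun_prop)
  set F : En (m+1) → ℝ≥0∞ := ({x : En (m+1) | |‖x‖ - k| ≤ lam * k}).indicator
    (fun x => ENNReal.ofReal (‖h (c + x)‖^2)) with hF
  have hFm : Measurable F := by
    apply Measurable.indicator
    · apply Continuous.measurable; apply ENNReal.continuous_ofReal.comp; fun_prop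
    · exact measurableSet_le (f := fun ξ : En (m+1) => |‖ξ‖ - k|) (g := fun _ => lam * k)
        (by fun_prop) (by fun_prop)
  have e1 : ∫⁻ ξ in {ξ | |‖ξ - c‖ - k| ≤ lam * k}, ENNReal.ofReal (‖h ξ‖^2) = ∫⁻ x, F x := by
    rw [← lintegral_indicator hS, ← lintegral_add_left_eq_self _ c]
    apply lintegral_congr
    intro x
    simp only [hF, indicator, mem_ofPred_eq, add_sub_cancel_left]
  have e2 : ∫⁻ x, ENNReal.ofReal (‖h x‖^2 + ‖fderiv ℝ h x‖^2) =
      ∫⁻ x, ENNReal.ofReal (‖h (c + x)‖^2 + ‖fderiv ℝ h (c + x)‖^2) :=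
    (lintegral_add_left_eq_self (fun x => ENNReal.ofReal (‖h x‖^2 + ‖fderiv ℝ h x‖^2)) c).symm
  rw [e1, e2, polar_lint m F hFm, polar_lint m _ (by apply Continuous.measurable; apply ENNReal.continuous_ofReal.comp; fun_prop),
    ← lintegral_const_mul' _ _ ENNReal.ofReal_ne_top]
  apply lintegral_mono
  intro ω
  have hω : ‖(ω : En (m+1))‖ = 1 := by simp
  set J := ∫⁻ r in Ioi (0:ℝ), ENNReal.ofReal (r^m) *
    ENNReal.ofReal (‖h (c + r • (ω : En (m+1)))‖^2 + ‖fderiv ℝ h (c + r • (ω : En (m+1)))‖^2)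
    with hJ
  change ∫⁻ r in Ioi (0:ℝ), ENNReal.ofReal (r^m) * F (r • (ω : En (m+1))) ≤
    ENNReal.ofReal (2*lam*k) * J
  have key : ∀ s ∈ Ioi (0:ℝ), ENNReal.ofReal (s^m) * F (s • (ω : En (m+1))) ≤
      (Icc (k - lam*k) (k + lam*k)).indicator (fun _ => J) s := by
    intro s hs
    have hs' : 0 < s := hs
    by_cases hmem : (s • (ω : En (m+1))) ∈ {x : En (m+1) | |‖x‖ - k| ≤ lam * k}
    · have hm2 : s ∈ Icc (k - lam*k) (k + lam*k) := by
        have h3 : |‖s • (ω : En (m+1))‖ - k| ≤ lam * k := hmem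
        rw [norm_smul, hω, mul_one, Real.norm_eq_abs, abs_of_pos hs', abs_le] at h3
        constructor <;> linarith [h3.1, h3.2]
      simp only [hF]
      rw [indicator_of_mem hmem, indicator_of_mem hm2]
      refine (mul_le_mul_right (ray_bound m h hh h0 c ω hω s) _).trans ?_
      rw [← lintegral_const_mul' _ _ ENNReal.ofReal_ne_top, hJ]
      refine le_trans ?_ (lintegral_mono_set (Ioi_subset_Ioi hs'.le))
      apply setLIntegral_mono' measurableSet_Ioi
      intro r hr
      have : s < r := hr
      gcongr
    · simp only [hF]
      rw [indicator_of_notMem hmem, mul_zero]; exact bot_le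
  refine (setLIntegral_mono' measurableSet_Ioi key).trans ?_
  refine (setLIntegral_le_lintegral _ _).trans ?_
  rw [lintegral_indicator measurableSet_Icc, lintegral_const, Measure.restrict_apply_univ,
    Real.volume_Icc, mul_comm]
  apply le_of_eq
  congr 2; ring

theorem opnorm_sq_le {n : ℕ} (L : En n →L[ℝ] ℂ) :
    ‖L‖^2 ≤ ∑ j : Fin n, ‖L (EuclideanSpace.single j (1:ℝ))‖^2 := by
  set S := ∑ j : Fin n, ‖L (EuclideanSpace.single j (1:ℝ))‖^2 with hS
  have hS0 : 0 ≤ S := Finset.sum_nonneg (fun _ _ => by positivity)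
  have h1 : ‖L‖ ≤ Real.sqrt S := by
    apply ContinuousLinearMap.opNorm_le_bound _ (Real.sqrt_nonneg _)
    intro x
    have hx : L x = ∑ j : Fin n, x j • L (EuclideanSpace.single j (1:ℝ)) := by
      conv_lhs => rw [← (EuclideanSpace.basisFun (Fin n) ℝ).sum_repr x]
      simp [map_sum]
    have h2 : ‖L x‖ ≤ ∑ j : Fin n, |x j| * ‖L (EuclideanSpace.single j (1:ℝ))‖ := by
      rw [hx]
      refine (norm_sum_le _ _).trans ?_
      apply Finset.sum_le_sum
      intro j _
      rw [norm_smul, Real.norm_eq_abs]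
    have h3 := Finset.sum_mul_sq_le_sq_mul_sq Finset.univ (fun j : Fin n => |x j|)
      (fun j => ‖L (EuclideanSpace.single j (1:ℝ))‖)
    have h4 : ∑ j : Fin n, |x j|^2 = ‖x‖^2 := by
      rw [EuclideanSpace.norm_sq_eq]; simp
    rw [h4, ← hS] at h3
    refine h2.trans ?_
    apply le_of_sq_le_sq _ (by positivity)
    rw [mul_pow, Real.sq_sqrt hS0, mul_comm]
    exact h3
  calc ‖L‖^2 ≤ (Real.sqrt S)^2 := by gcongr
    _ = S := Real.sq_sqrt hS0

theorem schwartz_sq_int {n : ℕ} (g : 𝓢(En n, ℂ)) : Integrable (fun x => ‖g x‖^2) := by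
  have := (g.memLp 2 (μ := (volume : Measure (En n)))).integrable_norm_pow (p := 2) (by norm_num)
  exact this

theorem sob_lemma {n : ℕ} (β : ℝ) (q : 𝓢(En n, ℂ)) : ∃ f : 𝓢(En n, ℂ),
    (∀ ξ, f ξ = (jap ξ ^ β : ℝ) • 𝓕 (⇑q) ξ) ∧
    ∫⁻ x, ENNReal.ofReal (‖f x‖^2 + ‖fderiv ℝ f x‖^2) ≤
      ENNReal.ofReal ((1 + (2*π)^2) * sobNorm β 2 q ^ 2) := by
  have hjap : ∀ (x : En n) (s : ℝ), jap x ^ s = (1 + ‖x‖^2) ^ (s/2) := by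
    intro x s
    rw [jap, Real.sqrt_eq_rpow, ← Real.rpow_mul (by positivity)]
    congr 1; ring
  have htg := Function.hasTemperateGrowth_one_add_norm_sq_rpow (En n) (β/2)
  set f : 𝓢(En n, ℂ) := SchwartzMap.smulLeftCLM ℂ (fun x : En n => (1 + ‖x‖^2)^(β/2)) (𝓕 q) with hf
  have hfx : ∀ ξ, f ξ = (jap ξ ^ β : ℝ) • 𝓕 (⇑q) ξ := by
    intro ξ
    rw [hf, SchwartzMap.smulLeftCLM_apply_apply htg, hjap, SchwartzMap.fourier_coe]
  refine ⟨f, hfx, ?_⟩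
  set F : 𝓢(En n, ℂ) := 𝓕⁻ f with hF
  have hFf : 𝓕 F = f := by rw [hF]; exact FourierTransform.fourier_fourierInv_eq f
  have hFc : 𝓕⁻ (fun ξ => (jap ξ ^ β : ℝ) • 𝓕 (⇑q) ξ) = ⇑F := by
    have : (fun ξ => (jap ξ ^ β : ℝ) • 𝓕 (⇑q) ξ) = ⇑f := by
      funext ξ; exact (hfx ξ).symm
    rw [this, hF, SchwartzMap.fourierInv_coe]
  have htg1 := Function.hasTemperateGrowth_one_add_norm_sq_rpow (En n) 1
  set G : 𝓢(En n, ℂ) := SchwartzMap.smulLeftCLM ℂ (fun x : En n => (1 + ‖x‖^2)^(1:ℝ)) F with hG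
  have hGx : ∀ x, ‖G x‖^2 = (1+‖x‖^2)^2 * ‖F x‖^2 := by
    intro x
    rw [hG, SchwartzMap.smulLeftCLM_apply_apply htg1, norm_smul, Real.rpow_one, mul_pow,
      Real.norm_eq_abs, sq_abs]
  have hsob : sobNorm β 2 q ^ 2 = ∫ x, ‖G x‖^2 := by
    have h1 : ∫ x, jap x ^ (2 * (2:ℝ)) * ‖𝓕⁻ (fun ξ => (jap ξ ^ β : ℝ) • 𝓕 (⇑q) ξ) x‖ ^ 2
        = ∫ x, ‖G x‖^2 := by
      rw [hFc]
      apply integral_congr_ae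
      apply Eventually.of_forall
      intro x
      simp only
      rw [hGx, hjap]
      norm_num
    rw [sobNorm, h1, ← Real.sqrt_eq_rpow, Real.sq_sqrt]
    exact integral_nonneg (fun x => by positivity)
  set X : Fin n → 𝓢(En n, ℂ) := fun j =>
    SchwartzMap.smulLeftCLM ℂ (fun x : En n => ⟪x, EuclideanSpace.single j (1:ℝ)⟫) F with hX
  have hXx : ∀ j x, X j x = x j • F x := by
    intro j x
    have : (fun x : En n => ⟪x, EuclideanSpace.single j (1:ℝ)⟫).HasTemperateGrowth :=
      ((innerSL ℝ).flip (EuclideanSpace.single j (1:ℝ))).hasTemperateGrowth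
    simp only [hX]
    rw [SchwartzMap.smulLeftCLM_apply_apply this]
    congr 1
    rw [EuclideanSpace.inner_single_right]
    simp
  set D : Fin n → 𝓢(En n, ℂ) := fun j => 𝓕 (-(2 * π * Complex.I) • X j) with hD
  have hDx : ∀ j x, fderiv ℝ f x (EuclideanSpace.single j (1:ℝ)) = D j x := by
    intro j x
    have h1 := SchwartzMap.lineDerivOp_fourier_eq F (EuclideanSpace.single j (1:ℝ))
    rw [hFf] at h1
    simp only [hD, hX]
    rw [← h1, SchwartzMap.lineDerivOp_apply_eq_fderiv]
  have hDint : ∀ j, ∫ x, ‖D j x‖^2 = (2*π)^2 * ∫ x, ‖X j x‖^2 := by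
    intro j
    simp only [hD]
    rw [SchwartzMap.integral_norm_sq_fourier, ← integral_const_mul]
    congr 1
    funext x
    rw [smul_apply, norm_smul, mul_pow]
    congr 1
    simp [abs_of_pos Real.pi_pos]
  have hfF : ∫ x, ‖f x‖^2 = ∫ x, ‖F x‖^2 := by
    rw [← hFf, SchwartzMap.integral_norm_sq_fourier]
  have hXsum : ∀ x, ∑ j, ‖X j x‖^2 = ‖x‖^2 * ‖F x‖^2 := by
    intro x
    rw [EuclideanSpace.norm_sq_eq, Finset.sum_mul]
    apply Finset.sum_congr rfl
    intro j _
    rw [hXx, norm_smul, mul_pow]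
  calc ∫⁻ x, ENNReal.ofReal (‖f x‖^2 + ‖fderiv ℝ f x‖^2)
      ≤ ∫⁻ x, ENNReal.ofReal (‖f x‖^2 + ∑ j, ‖D j x‖^2) := by
        apply lintegral_mono
        intro x
        apply ENNReal.ofReal_le_ofReal
        have := opnorm_sq_le (fderiv ℝ f x)
        simp only [hDx] at this
        linarith
    _ = ENNReal.ofReal (∫ x, (‖f x‖^2 + ∑ j, ‖D j x‖^2)) := by
        rw [ofReal_integral_eq_lintegral_ofReal]
        · exact (schwartz_sq_int f).add (integrable_finsetSum _ (fun j _ => schwartz_sq_int (D j)))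
        · exact Eventually.of_forall (fun x => by positivity)
    _ ≤ _ := by
        apply ENNReal.ofReal_le_ofReal
        rw [integral_add (schwartz_sq_int f)
          (integrable_finsetSum _ (fun j _ => schwartz_sq_int (D j))),
          integral_finsetSum _ (fun j _ => schwartz_sq_int (D j)), hfF, hsob]
        simp only [hDint]
        rw [← Finset.mul_sum, ← integral_finsetSum _ (fun j _ => schwartz_sq_int (X j)),
          add_mul, one_mul]
        simp only [hXsum]
        apply add_le_add
        · apply integral_mono (schwartz_sq_int F) (schwartz_sq_int G)
          intro x
          simp only [hGx]
          nlinarith [sq_nonneg (‖F x‖), sq_nonneg (‖x‖), mul_nonneg (sq_nonneg (‖F x‖)) (sq_nonneg (‖x‖)), mul_nonneg (sq_nonneg (‖F x‖)) (sq_nonneg (‖x‖^2))]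
        · apply mul_le_mul_of_nonneg_left _ (by positivity)
          apply integral_mono_of_nonneg _ (schwartz_sq_int G)
          · apply Eventually.of_forall
            intro x
            simp only [hGx]
            nlinarith [sq_nonneg (‖F x‖), sq_nonneg (‖x‖), mul_nonneg (sq_nonneg (‖F x‖)) (sq_nonneg (‖x‖)), mul_nonneg (sq_nonneg (‖F x‖)) (sq_nonneg (‖x‖^2))]
          · apply Eventually.of_forall
            intro x
            positivity

theorem cs_lint {n : ℕ} (f g : En n → ℝ≥0∞) (hf : Measurable f) (hg : Measurable g) :
    (∫⁻ x, f x * g x)^2 ≤ (∫⁻ x, f x ^ 2) * ∫⁻ x, g x ^ 2 := by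
  have h := ENNReal.lintegral_mul_le_Lp_mul_Lq (volume : Measure (En n))
    Real.HolderConjugate.two_two hf.aemeasurable hg.aemeasurable
  have h2 := pow_le_pow_left' h 2
  refine (le_of_eq ?_).trans (h2.trans (le_of_eq ?_))
  · rfl
  · rw [mul_pow, ← ENNReal.rpow_mul_natCast, ← ENNReal.rpow_mul_natCast]
    norm_num

theorem add_sq_lint (a b : ℝ≥0∞) : (a + b)^2 ≤ 4 * (a^2 + b^2) := by
  have key : ∀ a b : ℝ≥0∞, a ≤ b → (a + b)^2 ≤ 4 * (a^2 + b^2) := by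
    intro a b h
    calc (a+b)^2 ≤ (b+b)^2 := by gcongr
      _ = 4 * b^2 := by ring
      _ ≤ 4 * (a^2 + b^2) := by gcongr; exact le_add_self
  rcases le_total a b with h | h
  · exact key a b h
  · rw [add_comm a b, add_comm (a^2)]; exact key b a h

theorem point_real (α β γ ε δ b lam u j ja jb N : ℝ) (hβ : 0 ≤ β) (hγ : 2*α - 2*β = γ)
    (hγ0 : 0 ≤ γ) (hb : b ≤ 2*β) (hu : 0 < u) (hlam : 0 < lam) (hδ : 0 < δ) (hε : 0 < ε)
    (hul : u^2 ≤ lam/δ) (hN : 1 ≤ N) (hj : 0 < j) (hjN : j ≤ 2*N) (hja : j ≤ 10*ja) (hjb : 1 ≤ jb) :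
    j^(2*α) * (u^4 * (2*lam*u⁻¹)) * (ja^(-β) * jb^(-β))^2 ≤
      (2*10^(2*β)*2^γ*δ^(-ε)) * lam^(1+ε) * (N^γ * u^(3-2*ε) * jb^(-b)) := by
  have hja0 : 0 < ja := by linarith
  have hjb0 : 0 < jb := by linarith
  have e1 : (ja^(-β))^2 ≤ 10^(2*β) * j^(-(2*β)) := by
    rw [← Real.rpow_natCast, ← Real.rpow_mul hja0.le]
    have h1 : (-β) * ((2:ℕ):ℝ) = -(2*β) := by push_cast; ring
    rw [h1]
    have h2 : ja^(-(2*β)) ≤ (j/10)^(-(2*β)) :=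
      Real.rpow_le_rpow_of_nonpos (by positivity) (by linarith) (by linarith)
    refine h2.trans (le_of_eq ?_)
    rw [Real.div_rpow hj.le (by norm_num), Real.rpow_neg (by norm_num : (0:ℝ) ≤ 10)]
    field_simp
  have e2 : (jb^(-β))^2 ≤ jb^(-b) := by
    rw [← Real.rpow_natCast, ← Real.rpow_mul hjb0.le]
    apply Real.rpow_le_rpow_of_exponent_le hjb
    push_cast; linarith
  have e3 : j^(2*α) * j^(-(2*β)) ≤ 2^γ * N^γ := by
    rw [← Real.rpow_add hj, ← Real.mul_rpow (by norm_num) (by linarith)]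
    have : 2*α + -(2*β) = γ := by linarith
    rw [this]
    exact Real.rpow_le_rpow hj.le hjN hγ0
  have e4 : u^4 * (2*lam*u⁻¹) ≤ 2 * δ^(-ε) * lam^(1+ε) * u^(3-2*ε) := by
    have h1 : u^4 * (2*lam*u⁻¹) = 2 * lam * (u^(3-2*ε) * (u^2)^ε) := by
      have : u^(3-2*ε) * (u^2)^ε = u^3 := by
        rw [← Real.rpow_natCast u 2, ← Real.rpow_mul hu.le, ← Real.rpow_add hu,
          ← Real.rpow_natCast u 3]
        congr 1; push_cast; ring
      rw [this]; field_simp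
    have h2 : (u^2)^ε ≤ δ^(-ε) * lam^ε := by
      refine (Real.rpow_le_rpow (by positivity) hul hε.le).trans (le_of_eq ?_)
      rw [Real.div_rpow hlam.le hδ.le, Real.rpow_neg hδ.le]; field_simp
    rw [h1, Real.rpow_add hlam, Real.rpow_one]
    calc 2 * lam * (u^(3-2*ε) * (u^2)^ε) ≤ 2 * lam * (u^(3-2*ε) * (δ^(-ε) * lam^ε)) := by gcongr
      _ = _ := by ring
  rw [mul_pow]
  calc j^(2*α) * (u^4 * (2*lam*u⁻¹)) * ((ja^(-β))^2 * (jb^(-β))^2)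
      ≤ j^(2*α) * (2 * δ^(-ε) * lam^(1+ε) * u^(3-2*ε)) * ((10^(2*β) * j^(-(2*β))) * jb^(-b)) := by
        gcongr
    _ = (j^(2*α) * j^(-(2*β))) * (2 * δ^(-ε) * lam^(1+ε) * u^(3-2*ε) * 10^(2*β) * jb^(-b)) := by
        ring
    _ ≤ (2^γ * N^γ) * (2 * δ^(-ε) * lam^(1+ε) * u^(3-2*ε) * 10^(2*β) * jb^(-b)) := by
        gcongr
    _ = _ := by ring

theorem ufun_kval {n : ℕ} (θ η : En n) : ufun θ η = (kval θ η)⁻¹ := by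
  rw [ufun, kval, inv_div, neg_div, div_neg]

theorem kval_pos {n : ℕ} (θ η : En n) (h : ⟪θ, η⟫ < 0) (h1 : 1 ≤ ‖η‖) : 0 < kval θ η := by
  rw [kval]
  apply div_pos_of_neg_of_neg _ h
  have : 0 < ‖η‖ := by linarith
  have := sq_pos_of_pos this
  linarith

theorem shell_mem {n : ℕ} (θ : En n) (hθ : ‖θ‖ = 1) (lam : ℝ) (hl : 0 < lam) (hl1 : lam < 1)
    (ξ η : En n) (h : ⟪θ, η⟫ < 0) (h1 : 1 ≤ ‖η‖)
    (hs : |‖ξ - (-(kval θ η • θ))‖ - kval θ η| ≤ lam * kval θ η) :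
    (ξ, η) ∈ shellSet θ lam := by
  refine ⟨h, h1, ?_⟩
  change |(ufun θ η)^2*‖ξ‖^2 + 2*ufun θ η*⟪θ,ξ⟫| ≤ 3*lam
  have hk := kval_pos θ η h h1
  rw [ufun_kval]
  set k := kval θ η with hkd
  have e1 : ‖ξ - (-(k • θ))‖^2 = ‖ξ‖^2 + 2 * k * ⟪θ, ξ⟫ + k^2 := by
    rw [sub_neg_eq_add, norm_add_sq_real, inner_smul_right, norm_smul, hθ, real_inner_comm,
      Real.norm_eq_abs, mul_one, sq_abs]
    ring
  set ρ := ‖ξ - (-(k • θ))‖ with hρ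
  have hρ0 : 0 ≤ ρ := norm_nonneg _
  have e2 : (k⁻¹)^2 * ‖ξ‖^2 + 2 * k⁻¹ * ⟪θ, ξ⟫ = (ρ - k) * (ρ + k) / k^2 := by
    have : (ρ - k) * (ρ + k) = ‖ξ‖^2 + 2 * k * ⟪θ, ξ⟫ := by
      rw [show (ρ - k) * (ρ + k) = ρ^2 - k^2 by ring, e1]; ring
    rw [this]; field_simp
  rw [e2, abs_div, abs_mul, abs_of_pos (by positivity : 0 < ρ + k), abs_of_pos (by positivity : 0 < k^2),
    div_le_iff₀ (by positivity)]
  have h3 : ρ + k ≤ 3 * k := by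
    have := (abs_le.1 hs).2
    nlinarith
  calc |ρ - k| * (ρ + k) ≤ (lam * k) * (3 * k) := by gcongr
    _ = _ := by ring

theorem op_bound (m : ℕ) : ∃ C : ℝ≥0∞, C ≠ ⊤ ∧ ∀ (θ η : En (m+1)) (lam : ℝ) (x : ℝ)
    (q : 𝓢(En (m+1), ℂ)), ⟪η, θ⟫ < 0 → 0 < kval θ η → |x| ≤ 1 →
    ENNReal.ofReal (∫ r in {r : ℝ | 0 < r ∧ |1 - r| ≤ lam}, ‖(x : ℝ) • Sop θ r ⇑q η‖) ≤
      C * ENNReal.ofReal ((kval θ η)⁻¹^2) *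
        ∫⁻ ξ in {ξ | |‖ξ - (-(kval θ η • θ))‖ - kval θ η| ≤ lam * kval θ η},
          ENNReal.ofReal (‖𝓕 (⇑q) ξ‖ * ‖𝓕 (⇑q) (η - ξ)‖) := by
  obtain ⟨C, hC, H⟩ := shell_lint m
  refine ⟨C, hC, ?_⟩
  intro θ η lam x q hη hk hx
  set k := kval θ η with hkd
  have hqc : Continuous (𝓕 (⇑q)) := by
    rw [← SchwartzMap.fourier_coe]; exact (𝓕 q).continuous
  have hdim : (((m+1 : ℕ) : ℝ) - 1) = (m:ℝ) := by push_cast; ring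
  have hI : MeasurableSet {r : ℝ | 0 < r ∧ |1 - r| ≤ lam} :=
    (measurableSet_lt (f := fun _ : ℝ => (0:ℝ)) (g := fun r : ℝ => r) (by fun_prop)
      (by fun_prop)).inter
      (measurableSet_le (f := fun r : ℝ => |1 - r|) (g := fun _ : ℝ => lam) (by fun_prop)
        (by fun_prop))
  have hgm : Measurable (fun ξ => ENNReal.ofReal (‖𝓕 (⇑q) ξ‖ * ‖𝓕 (⇑q) (η - ξ)‖)) := by
    apply Continuous.measurable
    apply ENNReal.continuous_ofReal.comp
    fun_prop
  calc ENNReal.ofReal (∫ r in {r : ℝ | 0 < r ∧ |1 - r| ≤ lam}, ‖(x : ℝ) • Sop θ r ⇑q η‖)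
      ≤ ∫⁻ r in {r : ℝ | 0 < r ∧ |1 - r| ≤ lam}, ‖(x : ℝ) • Sop θ r ⇑q η‖ₑ := by
        have h1 := enorm_integral_le_lintegral_enorm
          (μ := volume.restrict {r : ℝ | 0 < r ∧ |1 - r| ≤ lam})
          (fun r => ‖(x : ℝ) • Sop θ r ⇑q η‖)
        simp only [enorm_norm] at h1
        refine le_trans ?_ h1
        rw [← ofReal_norm]
        exact ENNReal.ofReal_le_ofReal (le_abs_self _)
    _ ≤ ∫⁻ r in {r : ℝ | 0 < r ∧ |1 - r| ≤ lam}, ENNReal.ofReal k⁻¹ *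
          ∫⁻ ξ in sphere (-(k • θ)) (r*k), ENNReal.ofReal (‖𝓕 (⇑q) ξ‖ * ‖𝓕 (⇑q) (η - ξ)‖)
            ∂μH[(m:ℝ)] := by
        apply setLIntegral_mono' hI
        rintro r ⟨hr, hr1⟩
        rw [Sop, if_pos hη, hdim, smul_smul, enorm_smul]
        apply mul_le_mul'
        · rw [← ofReal_norm]
          apply ENNReal.ofReal_le_ofReal
          rw [norm_mul, Real.norm_eq_abs, Real.norm_eq_abs, ← hkd,
            abs_of_pos (by positivity : 0 < (k * (r+1))⁻¹)]
          calc |x| * (k * (r+1))⁻¹ ≤ 1 * k⁻¹ := by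
                gcongr
                nlinarith
            _ = k⁻¹ := one_mul _
        · refine (enorm_integral_le_lintegral_enorm _).trans (le_of_eq ?_)
          rw [ewald]
          apply lintegral_congr
          intro ξ
          rw [← ofReal_norm, norm_mul]
    _ ≤ ENNReal.ofReal k⁻¹ * (C * ENNReal.ofReal k⁻¹ * ∫⁻ ξ in {ξ | |‖ξ - (-(k • θ))‖ - k| ≤ lam * k},
          ENNReal.ofReal (‖𝓕 (⇑q) ξ‖ * ‖𝓕 (⇑q) (η - ξ)‖)) := by
        rw [lintegral_const_mul' _ _ ENNReal.ofReal_ne_top]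
        gcongr
        exact H (-(k • θ)) k lam hk _ hgm
    _ = _ := by
        rw [sq, ENNReal.ofReal_mul (p := k⁻¹) (by positivity)]
        ring

def wt {n : ℕ} (β : ℝ) (p : En n × En n) : ℝ := jap p.1 ^ (-β) * jap (p.2 - p.1) ^ (-β)

theorem meas_wt {n : ℕ} (β : ℝ) : Measurable (wt β : En n × En n → ℝ) := by
  unfold wt
  have h1 : Measurable (fun p : En n × En n => jap p.1) := meas_jap.comp (by fun_prop)
  have h2 : Measurable (fun p : En n × En n => jap (p.2 - p.1)) := meas_jap.comp (by fun_prop)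
  exact (h1.pow_const _).mul (h2.pow_const _)

theorem wt_nonneg {n : ℕ} (β : ℝ) (p : En n × En n) : 0 ≤ wt β p := by
  unfold wt
  have := jap_pos p.1
  have := jap_pos (p.2 - p.1)
  positivity

theorem trace_refl (m : ℕ) (f : 𝓢(En (m+1), ℂ)) (η c : En (m+1)) (k lam : ℝ) :
    ∫⁻ ξ in {ξ | |‖ξ - c‖ - k| ≤ lam * k}, ENNReal.ofReal (‖f (η - ξ)‖^2) ≤
      ENNReal.ofReal (2*lam*k) * ∫⁻ x, ENNReal.ofReal (‖f x‖^2 + ‖fderiv ℝ f x‖^2) := by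
  have hd : ∀ ξ, fderiv ℝ (fun ξ => f (η - ξ)) ξ = - fderiv ℝ f (η - ξ) := by
    intro ξ
    have h1 : HasFDerivAt (fun ξ : En (m+1) => η - ξ) (-(ContinuousLinearMap.id ℝ (En (m+1)))) ξ :=
      (hasFDerivAt_id ξ).const_sub η
    have h2 := (f.differentiableAt (x := η - ξ)).hasFDerivAt.comp ξ h1
    have h3 := h2.fderiv
    refine h3.trans ?_
    ext v
    simp
  have hcd : ContDiff ℝ 1 (fun ξ => f (η - ξ)) :=
    (f.smooth 1).comp (contDiff_const.sub contDiff_id)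
  have h0 : Tendsto (fun ξ => f (η - ξ)) (cocompact (En (m+1))) (nhds 0) := by
    have h1 : Tendsto (fun ξ : En (m+1) => η - ξ) (cocompact _) (cocompact _) :=
      (Homeomorph.subLeft η).isClosedEmbedding.tendsto_cocompact
    exact (f.tendsto_cocompact).comp h1
  have h := trace_shell m (fun ξ => f (η - ξ)) hcd h0 c k lam
  refine h.trans (le_of_eq ?_)
  congr 1
  simp only [hd, norm_neg]
  exact lintegral_sub_left_eq_self (fun x => ENNReal.ofReal (‖f x‖^2 + ‖fderiv ℝ f x‖^2)) η

theorem sq_bound (m : ℕ) (β : ℝ) (θ η : En (m+1)) (hθ : ‖θ‖ = 1) (lam : ℝ) (hl : 0 < lam)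
    (hl1 : lam < 1) (hη : ⟪θ, η⟫ < 0) (hη1 : 1 ≤ ‖η‖) (q : En (m+1) → ℂ)
    (f : 𝓢(En (m+1), ℂ)) (hf : ∀ ξ, f ξ = (jap ξ ^ β : ℝ) • q ξ) :
    (∫⁻ ξ in {ξ | |‖ξ - (-(kval θ η • θ))‖ - kval θ η| ≤ lam * kval θ η},
          ENNReal.ofReal (‖q ξ‖ * ‖q (η - ξ)‖))^2 ≤
      4 * (ENNReal.ofReal (2*lam*kval θ η) *
        (∫⁻ x, ENNReal.ofReal (‖f x‖^2 + ‖fderiv ℝ f x‖^2))) *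
      ((∫⁻ ξ, (setA θ lam).indicator (fun p => ENNReal.ofReal (wt β p ^ 2)) (ξ, η) *
          ENNReal.ofReal (‖f ξ‖^2)) +
        ∫⁻ ξ, (setB θ lam).indicator (fun p => ENNReal.ofReal (wt β p ^ 2)) (ξ, η) *
          ENNReal.ofReal (‖f (η - ξ)‖^2)) := by
  have hk := kval_pos θ η hη hη1
  set k := kval θ η with hkd
  set N := ∫⁻ x, ENNReal.ofReal (‖f x‖^2 + ‖fderiv ℝ f x‖^2) with hN
  set S : Set (En (m+1)) := {ξ | |‖ξ - (-(k • θ))‖ - k| ≤ lam * k} with hSd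
  have hS : MeasurableSet S :=
    measurableSet_le (f := fun ξ : En (m+1) => |‖ξ - (-(k • θ))‖ - k|) (g := fun _ => lam * k)
      (by fun_prop) (by fun_prop)
  have hq : ∀ ξ, ‖q ξ‖ = jap ξ ^ (-β) * ‖f ξ‖ := by
    intro ξ
    have hp : 0 < jap ξ ^ β := Real.rpow_pos_of_pos (jap_pos ξ) _
    rw [hf, norm_smul, Real.norm_eq_abs, abs_of_pos hp, Real.rpow_neg (jap_pos ξ).le]
    field_simp
  have hfc : Continuous f := f.continuous
  have hpair : Measurable (fun ξ : En (m+1) => (ξ, η)) := by fun_prop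
  have hw : Measurable (fun p : En (m+1) × En (m+1) => ENNReal.ofReal (wt β p)) :=
    (meas_wt β).ennreal_ofReal
  set A1 : En (m+1) → ℝ≥0∞ := fun ξ =>
    (setA θ lam).indicator (fun p => ENNReal.ofReal (wt β p)) (ξ, η) * ENNReal.ofReal ‖f ξ‖ with hA1
  set A2 : En (m+1) → ℝ≥0∞ := S.indicator (fun ξ => ENNReal.ofReal ‖f (η - ξ)‖) with hA2
  set B1 : En (m+1) → ℝ≥0∞ := fun ξ =>
    (setB θ lam).indicator (fun p => ENNReal.ofReal (wt β p)) (ξ, η) *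
      ENNReal.ofReal ‖f (η - ξ)‖ with hB1
  set B2 : En (m+1) → ℝ≥0∞ := S.indicator (fun ξ => ENNReal.ofReal ‖f ξ‖) with hB2
  have mA1 : Measurable A1 := by
    apply Measurable.mul
    · exact (hw.indicator (meas_setA θ lam)).comp hpair
    · apply Measurable.ennreal_ofReal; apply Continuous.measurable; fun_prop
  have mB1 : Measurable B1 := by
    apply Measurable.mul
    · exact (hw.indicator (meas_setB θ lam)).comp hpair
    · apply Measurable.ennreal_ofReal; apply Continuous.measurable; fun_prop
  have mA2 : Measurable A2 := by
    apply Measurable.indicator _ hS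
    apply Measurable.ennreal_ofReal; apply Continuous.measurable; fun_prop
  have mB2 : Measurable B2 := by
    apply Measurable.indicator _ hS
    apply Measurable.ennreal_ofReal; apply Continuous.measurable; fun_prop
  have hsplit : ∫⁻ ξ in S, ENNReal.ofReal (‖q ξ‖ * ‖q (η - ξ)‖) ≤
      (∫⁻ ξ, A1 ξ * A2 ξ) + ∫⁻ ξ, B1 ξ * B2 ξ := by
    rw [← lintegral_add_left (f := fun ξ => A1 ξ * A2 ξ) (mA1.mul mA2), ← lintegral_indicator hS]
    apply lintegral_mono
    intro ξ
    by_cases hξ : ξ ∈ S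
    · have hmem : (ξ, η) ∈ shellSet θ lam := shell_mem θ hθ lam hl hl1 ξ η hη hη1 hξ
      have hval : ENNReal.ofReal (‖q ξ‖ * ‖q (η - ξ)‖) =
          ENNReal.ofReal (wt β (ξ, η)) * ENNReal.ofReal ‖f ξ‖ * ENNReal.ofReal ‖f (η - ξ)‖ := by
        rw [← ENNReal.ofReal_mul (p := wt β (ξ, η)) (wt_nonneg β _),
          ← ENNReal.ofReal_mul (p := wt β (ξ, η) * ‖f ξ‖)
            (mul_nonneg (wt_nonneg β _) (norm_nonneg _)), hq, hq, wt]
        congr 1; ring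
      rw [indicator_of_mem hξ, hval]
      simp only [hA1, hA2, hB1, hB2, indicator_of_mem hξ]
      by_cases hAB : ‖η‖ ≤ 10 * ‖ξ‖
      · have : (ξ, η) ∈ setA θ lam := ⟨hmem, hAB⟩
        rw [indicator_of_mem this]
        exact le_self_add
      · have : (ξ, η) ∈ setB θ lam := ⟨hmem, not_le.1 hAB⟩
        rw [indicator_of_mem this (f := fun p => ENNReal.ofReal (wt β p))]
        refine le_trans (le_of_eq ?_) le_add_self
        ring
    · rw [indicator_of_notMem hξ]; exact bot_le
  have sqA1 : ∀ ξ, A1 ξ ^ 2 = (setA θ lam).indicator (fun p => ENNReal.ofReal (wt β p ^ 2)) (ξ, η) *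
          ENNReal.ofReal (‖f ξ‖^2) := by
    intro ξ
    simp only [hA1]
    rw [mul_pow, ENNReal.ofReal_pow (norm_nonneg _)]
    congr 1
    by_cases h : (ξ, η) ∈ setA θ lam
    · rw [indicator_of_mem h, indicator_of_mem h, ENNReal.ofReal_pow (wt_nonneg β _)]
    · rw [indicator_of_notMem h, indicator_of_notMem h]; simp
  have sqB1 : ∀ ξ, B1 ξ ^ 2 = (setB θ lam).indicator (fun p => ENNReal.ofReal (wt β p ^ 2)) (ξ, η) *
          ENNReal.ofReal (‖f (η - ξ)‖^2) := by
    intro ξ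
    simp only [hB1]
    rw [mul_pow, ENNReal.ofReal_pow (norm_nonneg _)]
    congr 1
    by_cases h : (ξ, η) ∈ setB θ lam
    · rw [indicator_of_mem h, indicator_of_mem h, ENNReal.ofReal_pow (wt_nonneg β _)]
    · rw [indicator_of_notMem h, indicator_of_notMem h]; simp
  have hA2i : ∫⁻ ξ, A2 ξ ^ 2 ≤ ENNReal.ofReal (2*lam*k) * N := by
    refine le_trans (le_of_eq ?_) (trace_refl m f η (-(k • θ)) k lam)
    rw [← hSd, ← lintegral_indicator hS]
    apply lintegral_congr
    intro ξ
    by_cases h : ξ ∈ S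
    · simp only [hA2]
      rw [indicator_of_mem h, indicator_of_mem h, ENNReal.ofReal_pow (norm_nonneg _)]
    · simp only [hA2]
      rw [indicator_of_notMem h, indicator_of_notMem h]; simp
  have hB2i : ∫⁻ ξ, B2 ξ ^ 2 ≤ ENNReal.ofReal (2*lam*k) * N := by
    refine le_trans (le_of_eq ?_) (trace_shell m f (f.smooth 1) f.tendsto_cocompact (-(k • θ)) k lam)
    rw [← hSd, ← lintegral_indicator hS]
    apply lintegral_congr
    intro ξ
    by_cases h : ξ ∈ S
    · simp only [hB2]
      rw [indicator_of_mem h, indicator_of_mem h, ENNReal.ofReal_pow (norm_nonneg _)]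
    · simp only [hB2]
      rw [indicator_of_notMem h, indicator_of_notMem h]; simp
  simp only [← sqA1, ← sqB1]
  calc _ ≤ ((∫⁻ ξ, A1 ξ * A2 ξ) + ∫⁻ ξ, B1 ξ * B2 ξ)^2 := pow_le_pow_left' hsplit 2
    _ ≤ 4 * ((∫⁻ ξ, A1 ξ * A2 ξ)^2 + (∫⁻ ξ, B1 ξ * B2 ξ)^2) := add_sq_lint _ _
    _ ≤ 4 * ((∫⁻ ξ, A1 ξ ^2) * (ENNReal.ofReal (2*lam*k) * N) +
          (∫⁻ ξ, B1 ξ ^2) * (ENNReal.ofReal (2*lam*k) * N)) := by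
        gcongr
        · exact (cs_lint A1 A2 mA1 mA2).trans (by gcongr)
        · exact (cs_lint B1 B2 mB1 mB2).trans (by gcongr)
    _ = _ := by ring

theorem kA_point {n : ℕ} (α β γ ε δ b lam : ℝ) (hβ : 0 ≤ β) (hγ : 2*α - 2*β = γ)
    (hγ0 : 0 ≤ γ) (hb : b ≤ 2*β) (hlam : 0 < lam) (hδ : 0 < δ) (hε : 0 < ε)
    (θ ξ η : En n) (hη : ⟪θ, η⟫ < 0) (hη1 : 1 ≤ ‖η‖) (hk : δ/lam < kval θ η ^ 2) :
    ENNReal.ofReal (jap η^(2*α) * ((kval θ η)⁻¹^4 * (2*lam*kval θ η))) *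
      (setA θ lam).indicator (fun p => ENNReal.ofReal (wt β p ^ 2)) (ξ, η) ≤
    ENNReal.ofReal ((2*10^(2*β)*2^γ*δ^(-ε)) * lam^(1+ε)) * kA γ ε b θ lam (ξ, η) := by
  by_cases h : (ξ, η) ∈ setA θ lam
  · have hk0 := kval_pos θ η hη hη1
    have hj := jap_pos η
    have hAB : ‖η‖ ≤ 10 * ‖ξ‖ := h.2
    rw [kA, indicator_of_mem h, indicator_of_mem h,
      ← ENNReal.ofReal_mul (p := jap η^(2*α) * ((kval θ η)⁻¹^4 * (2*lam*kval θ η))) (by positivity),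
      ← ENNReal.ofReal_mul (p := (2*10^(2*β)*2^γ*δ^(-ε)) * lam^(1+ε)) (by positivity)]
    apply ENNReal.ofReal_le_ofReal
    simp only [wt]
    rw [ufun_kval]
    have hul : ((kval θ η)⁻¹)^2 ≤ lam/δ := by
      rw [inv_pow, ← inv_div]
      exact inv_anti₀ (by positivity) hk.le
    have hja : jap η ≤ 10 * jap ξ := by
      apply le_of_sq_le_sq _ (by have := jap_pos ξ; positivity)
      rw [mul_pow, jap_sq, jap_sq]
      nlinarith [norm_nonneg η, norm_nonneg ξ]
    have := point_real α β γ ε δ b lam (kval θ η)⁻¹ (jap η) (jap ξ) (jap (η - ξ)) ‖η‖ hβ hγ hγ0 hb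
      (by positivity) hlam hδ hε hul hη1 hj (jap_le_two η hη1) hja (jap_ge_one _)
    rw [inv_inv] at this
    exact this
  · rw [indicator_of_notMem h, mul_zero]; exact bot_le

theorem kB_point {n : ℕ} (α β γ ε δ b lam : ℝ) (hβ : 0 ≤ β) (hγ : 2*α - 2*β = γ)
    (hγ0 : 0 ≤ γ) (hb : b ≤ 2*β) (hlam : 0 < lam) (hδ : 0 < δ) (hε : 0 < ε)
    (θ ξ η : En n) (hη : ⟪θ, η⟫ < 0) (hη1 : 1 ≤ ‖η‖) (hk : δ/lam < kval θ η ^ 2) :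
    ENNReal.ofReal (jap η^(2*α) * ((kval θ η)⁻¹^4 * (2*lam*kval θ η))) *
      (setB θ lam).indicator (fun p => ENNReal.ofReal (wt β p ^ 2)) (ξ, η) ≤
    ENNReal.ofReal ((2*10^(2*β)*2^γ*δ^(-ε)) * lam^(1+ε)) * kB γ ε b θ lam (ξ, η) := by
  by_cases h : (ξ, η) ∈ setB θ lam
  · have hk0 := kval_pos θ η hη hη1
    have hj := jap_pos η
    have hAB : 10 * ‖ξ‖ < ‖η‖ := h.2
    rw [kB, indicator_of_mem h, indicator_of_mem h,
      ← ENNReal.ofReal_mul (p := jap η^(2*α) * ((kval θ η)⁻¹^4 * (2*lam*kval θ η))) (by positivity),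
      ← ENNReal.ofReal_mul (p := (2*10^(2*β)*2^γ*δ^(-ε)) * lam^(1+ε)) (by positivity)]
    apply ENNReal.ofReal_le_ofReal
    simp only [wt]
    rw [ufun_kval]
    have hul : ((kval θ η)⁻¹)^2 ≤ lam/δ := by
      rw [inv_pow, ← inv_div]
      exact inv_anti₀ (by positivity) hk.le
    have hja : jap η ≤ 10 * jap (η - ξ) := by
      apply le_of_sq_le_sq _ (by have := jap_pos (η - ξ); positivity)
      rw [mul_pow, jap_sq, jap_sq]
      have := norm_sub_norm_le η ξ
      nlinarith [norm_nonneg η, norm_nonneg ξ, norm_nonneg (η - ξ)]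
    have := point_real α β γ ε δ b lam (kval θ η)⁻¹ (jap η) (jap (η - ξ)) (jap ξ) ‖η‖ hβ hγ hγ0 hb
      (by positivity) hlam hδ hε hul hη1 hj (jap_le_two η hη1) hja (jap_ge_one _)
    rw [inv_inv, mul_comm (jap (η - ξ) ^ (-β))] at this
    exact this
  · rw [indicator_of_notMem h, mul_zero]; exact bot_le

theorem core (m : ℕ) (hm : 1 ≤ m) (α β γ ε δ C₀ b : ℝ) (hβ : 0 ≤ β) (hγ : 2*α - 2*β = γ)
    (hγ0 : 0 ≤ γ) (hb0 : 0 ≤ b) (hb : b ≤ 2*β) (hbm : b < m) (hs : γ + (m - b) ≤ 2 - 2*ε)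
    (hδ : 0 < δ) (hε : 0 < ε) (hC₀ : 1 < C₀)
    (χ : En (m+1) → ℝ) (hχ : IsCutoff C₀ χ) :
    ∃ C : ℝ≥0∞, C ≠ ⊤ ∧ ∀ θ : En (m+1), ‖θ‖ = 1 → ∀ lam : ℝ, 0 < lam → lam < 1 →
      ∀ q : 𝓢(En (m+1), ℂ),
      ∫⁻ η, ENNReal.ofReal (jap η ^ (2*α) * ‖(if ⟪η, θ⟫ < 0 ∧ δ / lam < kval θ η ^ 2 then
            ∫ r in {r : ℝ | 0 < r ∧ |1 - r| ≤ lam}, ‖(χ η : ℝ) • Sop θ r ⇑q η‖ else 0)‖^2) ≤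
      C * ENNReal.ofReal (lam^(2+ε)) * (ENNReal.ofReal (sobNorm β 2 q ^ 2))^2 := by
  obtain ⟨C1, hC1, H1⟩ := op_bound m
  obtain ⟨KA, hKA, HA⟩ := kernelA m hm γ ε b hγ0 hb0 hbm hs
  obtain ⟨KB, hKB, HB⟩ := kernelB m hm γ ε b hγ0 hb0 hbm hs
  set M : ℝ := 2*10^(2*β)*2^γ*δ^(-ε) with hM
  have hM0 : 0 < M := by positivity
  refine ⟨C1^2 * 4 * ENNReal.ofReal M * (KA + KB) * ENNReal.ofReal (1 + (2*π)^2) ^ 2, ?_, ?_⟩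
  · refine ENNReal.mul_ne_top (ENNReal.mul_ne_top (ENNReal.mul_ne_top (ENNReal.mul_ne_top
      (ENNReal.pow_ne_top hC1) (by norm_num)) ENNReal.ofReal_ne_top) (ENNReal.add_ne_top.2 ⟨hKA, hKB⟩))
      (ENNReal.pow_ne_top ENNReal.ofReal_ne_top)
  intro θ hθ lam hl hl1 q
  obtain ⟨f, hf, hfN⟩ := sob_lemma β q
  set N := ∫⁻ x, ENNReal.ofReal (‖f x‖^2 + ‖fderiv ℝ f x‖^2) with hN
  have hfc : Continuous f := f.continuous
  have mf : Measurable (fun x => ENNReal.ofReal (‖f x‖^2)) := by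
    apply Measurable.ennreal_ofReal; apply Continuous.measurable; fun_prop
  have hfle : ∫⁻ x, ENNReal.ofReal (‖f x‖^2) ≤ N := by
    apply lintegral_mono
    intro x
    apply ENNReal.ofReal_le_ofReal
    nlinarith [sq_nonneg (‖fderiv ℝ f x‖)]
  set D := C1^2 * 4 * N * ENNReal.ofReal (M * lam^(1+ε)) with hD
  have hpt : ∀ η, ENNReal.ofReal (jap η ^ (2*α) * ‖(if ⟪η, θ⟫ < 0 ∧ δ / lam < kval θ η ^ 2 then
            ∫ r in {r : ℝ | 0 < r ∧ |1 - r| ≤ lam}, ‖(χ η : ℝ) • Sop θ r ⇑q η‖ else 0)‖^2) ≤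
      D * ((∫⁻ ξ, kA γ ε b θ lam (ξ, η) * ENNReal.ofReal (‖f ξ‖^2)) +
        ∫⁻ ξ, kB γ ε b θ lam (ξ, η) * ENNReal.ofReal (‖f (η - ξ)‖^2)) := by
    intro η
    by_cases hc : ⟪η, θ⟫ < 0 ∧ δ / lam < kval θ η ^ 2
    swap
    · rw [if_neg hc]; simp
    rw [if_pos hc]
    rcases lt_or_ge ‖η‖ 1 with h1 | h1
    · have : χ η = 0 := hχ.eq_zero η (by linarith)
      simp [this]
    have hη : ⟪θ, η⟫ < 0 := by rw [real_inner_comm]; exact hc.1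
    have hk := kval_pos θ η hη h1
    have hx : |χ η| ≤ 1 := by
      have := hχ.mem_Icc η
      rw [abs_of_nonneg this.1]; exact this.2
    have hP := H1 θ η lam (χ η) q hc.1 hk hx
    set P := ∫ r in {r : ℝ | 0 < r ∧ |1 - r| ≤ lam}, ‖(χ η : ℝ) • Sop θ r ⇑q η‖ with hPd
    have hP0 : 0 ≤ P := integral_nonneg (fun r => norm_nonneg _)
    have hsq := sq_bound m β θ η hθ lam hl hl1 hη h1 (𝓕 (⇑q)) f hf
    set T := ∫⁻ ξ in {ξ | |‖ξ - (-(kval θ η • θ))‖ - kval θ η| ≤ lam * kval θ η},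
          ENNReal.ofReal (‖𝓕 (⇑q) ξ‖ * ‖𝓕 (⇑q) (η - ξ)‖) with hT
    set k := kval θ η with hkd
    set IA := ∫⁻ ξ, (setA θ lam).indicator (fun p => ENNReal.ofReal (wt β p ^ 2)) (ξ, η) *
          ENNReal.ofReal (‖f ξ‖^2) with hIA
    set IB := ∫⁻ ξ, (setB θ lam).indicator (fun p => ENNReal.ofReal (wt β p ^ 2)) (ξ, η) *
          ENNReal.ofReal (‖f (η - ξ)‖^2) with hIB
    have hj := jap_pos η
    set R := ENNReal.ofReal (jap η^(2*α) * (k⁻¹^4 * (2*lam*k))) with hR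
    have hRA : R * IA ≤ ENNReal.ofReal (M * lam^(1+ε)) *
        ∫⁻ ξ, kA γ ε b θ lam (ξ, η) * ENNReal.ofReal (‖f ξ‖^2) := by
      rw [hIA, ← lintegral_const_mul' _ _ ENNReal.ofReal_ne_top,
        ← lintegral_const_mul' _ _ ENNReal.ofReal_ne_top]
      apply lintegral_mono
      intro ξ
      simp only
      have hp := kA_point α β γ ε δ b lam hβ hγ hγ0 hb hl hδ hε θ ξ η hη h1 hc.2
      exact (le_of_eq (mul_assoc _ _ _).symm).trans
        (le_trans (mul_le_mul' hp le_rfl) (le_of_eq (mul_assoc _ _ _)))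
    have hRB : R * IB ≤ ENNReal.ofReal (M * lam^(1+ε)) *
        ∫⁻ ξ, kB γ ε b θ lam (ξ, η) * ENNReal.ofReal (‖f (η - ξ)‖^2) := by
      rw [hIB, ← lintegral_const_mul' _ _ ENNReal.ofReal_ne_top,
        ← lintegral_const_mul' _ _ ENNReal.ofReal_ne_top]
      apply lintegral_mono
      intro ξ
      simp only
      have hp := kB_point α β γ ε δ b lam hβ hγ hγ0 hb hl hδ hε θ ξ η hη h1 hc.2
      exact (le_of_eq (mul_assoc _ _ _).symm).trans
        (le_trans (mul_le_mul' hp le_rfl) (le_of_eq (mul_assoc _ _ _)))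
    have hRe : R = ENNReal.ofReal (jap η^(2*α)) * (ENNReal.ofReal (k⁻¹^2))^2 *
        ENNReal.ofReal (2*lam*k) := by
      rw [hR, ← ENNReal.ofReal_pow (by positivity), ← ENNReal.ofReal_mul (by positivity),
        ← ENNReal.ofReal_mul (by positivity)]
      congr 1; ring
    calc ENNReal.ofReal (jap η^(2*α) * ‖P‖^2)
        = ENNReal.ofReal (jap η^(2*α)) * (ENNReal.ofReal P)^2 := by
          rw [Real.norm_eq_abs, sq_abs, ENNReal.ofReal_mul (by positivity), ENNReal.ofReal_pow hP0]
      _ ≤ ENNReal.ofReal (jap η^(2*α)) * (C1 * ENNReal.ofReal (k⁻¹^2) * T)^2 := by gcongr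
      _ = ENNReal.ofReal (jap η^(2*α)) * C1^2 * (ENNReal.ofReal (k⁻¹^2))^2 * T^2 := by ring
      _ ≤ ENNReal.ofReal (jap η^(2*α)) * C1^2 * (ENNReal.ofReal (k⁻¹^2))^2 *
            (4 * (ENNReal.ofReal (2*lam*k) * N) * (IA + IB)) := by gcongr
      _ = C1^2 * 4 * N * (R * IA + R * IB) := by rw [hRe]; ring
      _ ≤ C1^2 * 4 * N * (ENNReal.ofReal (M * lam^(1+ε)) *
            (∫⁻ ξ, kA γ ε b θ lam (ξ, η) * ENNReal.ofReal (‖f ξ‖^2)) +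
          ENNReal.ofReal (M * lam^(1+ε)) *
            ∫⁻ ξ, kB γ ε b θ lam (ξ, η) * ENNReal.ofReal (‖f (η - ξ)‖^2)) := by gcongr
      _ = _ := by rw [hD]; ring
  have mkA : Measurable (fun p : En (m+1) × En (m+1) =>
      kA γ ε b θ lam (p.2, p.1) * ENNReal.ofReal (‖f p.2‖^2)) :=
    ((meas_kA γ ε b θ lam).comp measurable_swap).mul (mf.comp measurable_snd)
  have mkB : Measurable (fun p : En (m+1) × En (m+1) =>
      kB γ ε b θ lam (p.2, p.1) * ENNReal.ofReal (‖f (p.1 - p.2)‖^2)) :=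
    ((meas_kB γ ε b θ lam).comp measurable_swap).mul
      (mf.comp (measurable_fst.sub measurable_snd))
  have hTA : ∫⁻ η, ∫⁻ ξ, kA γ ε b θ lam (ξ, η) * ENNReal.ofReal (‖f ξ‖^2) ≤
      KA * ENNReal.ofReal lam * N := by
    rw [lintegral_lintegral_swap mkA.aemeasurable]
    calc ∫⁻ ξ, ∫⁻ η, kA γ ε b θ lam (ξ, η) * ENNReal.ofReal (‖f ξ‖^2)
        ≤ ∫⁻ ξ, (KA * ENNReal.ofReal lam) * ENNReal.ofReal (‖f ξ‖^2) := by
          apply lintegral_mono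
          intro ξ
          simp only
          rw [lintegral_mul_const' _ _ ENNReal.ofReal_ne_top]
          gcongr
          exact HA θ hθ lam hl ξ
      _ ≤ _ := by
          rw [lintegral_const_mul _ mf]
          gcongr
  have hTB : ∫⁻ η, ∫⁻ ξ, kB γ ε b θ lam (ξ, η) * ENNReal.ofReal (‖f (η - ξ)‖^2) ≤
      KB * ENNReal.ofReal lam * N := by
    rw [lintegral_lintegral_swap mkB.aemeasurable]
    have e : ∀ ξ, ∫⁻ η, kB γ ε b θ lam (ξ, η) * ENNReal.ofReal (‖f (η - ξ)‖^2) =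
        ∫⁻ ζ, kB γ ε b θ lam (ξ, ζ + ξ) * ENNReal.ofReal (‖f ζ‖^2) := by
      intro ξ
      rw [← lintegral_add_right_eq_self _ ξ]
      simp only [add_sub_cancel_right]
    simp only [e]
    rw [lintegral_lintegral_swap]
    swap
    · apply Measurable.aemeasurable
      apply Measurable.mul
      · exact (meas_kB γ ε b θ lam).comp
          (measurable_fst.prodMk (measurable_snd.add measurable_fst))
      · exact mf.comp measurable_snd
    calc ∫⁻ ζ, ∫⁻ ξ, kB γ ε b θ lam (ξ, ζ + ξ) * ENNReal.ofReal (‖f ζ‖^2)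
        ≤ ∫⁻ ζ, (KB * ENNReal.ofReal lam) * ENNReal.ofReal (‖f ζ‖^2) := by
          apply lintegral_mono
          intro ζ
          simp only
          rw [lintegral_mul_const' _ _ ENNReal.ofReal_ne_top]
          gcongr
          exact HB θ hθ lam hl ζ
      _ ≤ _ := by
          rw [lintegral_const_mul _ mf]
          gcongr
  have hNtop : N ≠ ⊤ := ne_top_of_le_ne_top ENNReal.ofReal_ne_top hfN
  have hDtop : D ≠ ⊤ := ENNReal.mul_ne_top (ENNReal.mul_ne_top (ENNReal.mul_ne_top
      (ENNReal.pow_ne_top hC1) (by norm_num)) hNtop) ENNReal.ofReal_ne_top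
  have hlamp : lam^(2+ε) = lam^(1+ε) * lam := by
    rw [show 2 + ε = (1+ε) + 1 by ring, Real.rpow_add hl (1+ε) 1, Real.rpow_one]
  calc _ ≤ ∫⁻ η, D * ((∫⁻ ξ, kA γ ε b θ lam (ξ, η) * ENNReal.ofReal (‖f ξ‖^2)) +
        ∫⁻ ξ, kB γ ε b θ lam (ξ, η) * ENNReal.ofReal (‖f (η - ξ)‖^2)) := lintegral_mono hpt
    _ = D * ((∫⁻ η, ∫⁻ ξ, kA γ ε b θ lam (ξ, η) * ENNReal.ofReal (‖f ξ‖^2)) +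
        ∫⁻ η, ∫⁻ ξ, kB γ ε b θ lam (ξ, η) * ENNReal.ofReal (‖f (η - ξ)‖^2)) := by
        rw [lintegral_const_mul' _ _ hDtop, lintegral_add_left]
        exact mkA.lintegral_prod_right'
    _ ≤ D * (KA * ENNReal.ofReal lam * N + KB * ENNReal.ofReal lam * N) := by gcongr
    _ = C1^2 * 4 * ENNReal.ofReal M * (KA + KB) * ENNReal.ofReal (lam^(2+ε)) * N^2 := by
        rw [hD, hlamp, ENNReal.ofReal_mul (p := M) hM0.le, ENNReal.ofReal_mul (p := lam^(1+ε)) (by positivity)]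
        ring
    _ ≤ C1^2 * 4 * ENNReal.ofReal M * (KA + KB) * ENNReal.ofReal (lam^(2+ε)) *
          (ENNReal.ofReal ((1 + (2*π)^2) * sobNorm β 2 q ^ 2))^2 := by gcongr
    _ = _ := by
        rw [ENNReal.ofReal_mul (p := 1 + (2*π)^2) (by positivity)]
        ring

/-- Estimate for the sublinear truncated operators `P^λ` appearing in the proof of
Proposition 4.1: `‖P^λ(q)‖_{L²_α} ≤ C λ^{1+ε/2} ‖q‖²_{W^{β,2}_2}`, where
`P^λ(q)(η) = 1_{{k² > δ/λ}} ∫_{|1-r| ≤ λ} |χ(η) S_{θ,r}(q)(η)| dr`. -/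
theorem truncated_sublinear_operator_estimate (n : ℕ) (hn : 2 ≤ n) (β ε δ C₀ α : ℝ)
    (hβ : 0 ≤ β) (hε0 : 0 < ε) (hε1 : ε < 1) (hδ0 : 0 < δ) (hδ1 : δ < 1) (hC₀ : 1 < C₀)
    (χ : En n → ℝ) (hχ : IsCutoff C₀ χ)
    (hα : (((n : ℝ) - 3) / 2 + ε < β ∧ β < ((n : ℝ) - 1) / 2 ∧
            α ≤ 2 * β - ((n : ℝ) - 3) / 2 - ε) ∨
          (((n : ℝ) - 1) / 2 ≤ β ∧ α < β + 1 - ε)) :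
    ∃ C : ℝ, 0 < C ∧ ∀ θ : En n, ‖θ‖ = 1 → ∀ lam : ℝ, 0 < lam → lam < 1 →
      ∀ q : 𝓢(En n, ℂ),
        L2w α (fun η => if ⟪η, θ⟫ < 0 ∧ δ / lam < kval θ η ^ 2 then
            ∫ r in {r : ℝ | 0 < r ∧ |1 - r| ≤ lam}, ‖(χ η : ℝ) • Sop θ r ⇑q η‖ else 0)
          ≤ C * lam ^ (1 + ε / 2) * sobNorm β 2 ⇑q ^ 2 := by
  obtain ⟨m, rfl⟩ : ∃ m, n = m + 1 := ⟨n - 1, by omega⟩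
  have hm : 1 ≤ m := by omega
  have hm1 : (1:ℝ) ≤ m := by exact_mod_cast hm
  push_cast at hα
  obtain ⟨α', b, hαα, hα'β, hb0, hb, hbm, hs⟩ : ∃ α' b : ℝ, α ≤ α' ∧ β ≤ α' ∧ 0 ≤ b ∧ b ≤ 2*β ∧
      b < m ∧ (2*α' - 2*β) + (m - b) ≤ 2 - 2*ε := by
    rcases hα with ⟨h1, h2, h3⟩ | ⟨h1, h2⟩
    · refine ⟨max α β, 2*β, le_max_left _ _, le_max_right _ _, by linarith, le_rfl, by linarith, ?_⟩
      rcases max_cases α β with ⟨h, _⟩ | ⟨h, _⟩ <;> rw [h] <;> linarith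
    · have h4 : max α β < β + 1 - ε := max_lt h2 (by linarith)
      have h5 : 0 < min (2 - 2*ε - (2*max α β - 2*β)) (m:ℝ) := lt_min (by linarith) (by linarith)
      have h6 := min_le_left (2 - 2*ε - (2*max α β - 2*β)) (m:ℝ)
      have h7 := min_le_right (2 - 2*ε - (2*max α β - 2*β)) (m:ℝ)
      refine ⟨max α β, m - min (2 - 2*ε - (2*max α β - 2*β)) (m:ℝ), le_max_left _ _,
        le_max_right _ _, by linarith, by linarith, by linarith, by linarith⟩
  obtain ⟨C, hC, H⟩ := core m hm α' β (2*α' - 2*β) ε δ C₀ b hβ rfl (by linarith) hb0 hb hbm hs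
    hδ0 hε0 hC₀ χ hχ
  refine ⟨Real.sqrt C.toReal + 1, by positivity, ?_⟩
  intro θ hθ lam hl hl1 q
  have h := H θ hθ lam hl hl1 q
  set P : En (m+1) → ℝ := fun η => if ⟪η, θ⟫ < 0 ∧ δ / lam < kval θ η ^ 2 then
            ∫ r in {r : ℝ | 0 < r ∧ |1 - r| ≤ lam}, ‖(χ η : ℝ) • Sop θ r ⇑q η‖ else 0 with hP
  set S := sobNorm β 2 ⇑q with hS
  have hfin : C * ENNReal.ofReal (lam^(2+ε)) * (ENNReal.ofReal (S ^ 2))^2 ≠ ⊤ :=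
    ENNReal.mul_ne_top (ENNReal.mul_ne_top hC ENNReal.ofReal_ne_top)
      (ENNReal.pow_ne_top ENNReal.ofReal_ne_top)
  have hI : ∫ η, jap η ^ (2 * α) * ‖P η‖ ^ 2 ≤ C.toReal * lam^(2+ε) * (S^2)^2 := by
    have h1 : ∫ η, jap η ^ (2 * α) * ‖P η‖ ^ 2 ≤
        ENNReal.toReal (∫⁻ η, ENNReal.ofReal ‖jap η ^ (2 * α) * ‖P η‖ ^ 2‖) :=
      (Real.le_norm_self _).trans (norm_integral_le_lintegral_norm _)
    refine h1.trans ?_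
    have h2 : ∫⁻ η, ENNReal.ofReal ‖jap η ^ (2 * α) * ‖P η‖ ^ 2‖ ≤
        C * ENNReal.ofReal (lam^(2+ε)) * (ENNReal.ofReal (S ^ 2))^2 := by
      refine le_trans (lintegral_mono ?_) h
      intro η
      apply ENNReal.ofReal_le_ofReal
      have hj := jap_pos η
      rw [Real.norm_eq_abs, abs_of_nonneg (by positivity)]
      apply mul_le_mul_of_nonneg_right _ (by positivity)
      exact Real.rpow_le_rpow_of_exponent_le (jap_ge_one η) (by linarith)
    refine (ENNReal.toReal_mono hfin h2).trans (le_of_eq ?_)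
    rw [ENNReal.toReal_mul, ENNReal.toReal_mul, ENNReal.toReal_pow,
      ENNReal.toReal_ofReal (by positivity), ENNReal.toReal_ofReal (by positivity)]
  rw [L2w, ← Real.sqrt_eq_rpow]
  refine (Real.sqrt_le_sqrt hI).trans ?_
  have hl2 : lam^(2+ε) = (lam^(1+ε/2))^2 := by
    rw [← Real.rpow_natCast, ← Real.rpow_mul hl.le]
    congr 1; push_cast; ring
  rw [Real.sqrt_mul (by positivity), Real.sqrt_mul (by positivity), hl2,
    Real.sqrt_sq (by positivity), Real.sqrt_sq (by positivity)]
  gcongr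
  linarith

end
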